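/- arXiv:2205.13653 — 6 statements merged into one kernel-verified Lean document; each statement's English description precedes it below -/
import Mathlib

section
/- Strong duality holds between (SDP-P) and (SDP-D): the supremum of Σ_{i=1}^k tr(M_i X_i) over all primal feasible tuples equals the infimum of tr(Y) + Σ_{i=1}^k ν_i over all dual feasible tuples, and both the supremum and the infimum are attained. -/
open Matrix

/-- Objective of the primal SDP (SDP-P): `∑ i, tr (M i * X i)`. -/
noncomputable def primalObj {d k : ℕ} (M X : Fin k → Matrix (Fin d) (Fin d) ℝ) : ℝ :=
  ∑ i, (M i * X i).trace

/-- Feasibility for the primal SDP (SDP-P). -/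
def PrimalFeasible {d k : ℕ} (X : Fin k → Matrix (Fin d) (Fin d) ℝ) : Prop :=
  (∀ i, (X i).PosSemidef) ∧ (∀ i, (X i).trace = 1) ∧
    ((1 : Matrix (Fin d) (Fin d) ℝ) - ∑ i, X i).PosSemidef

/-- Objective of the dual SDP (SDP-D): `tr Y + ∑ i, ν i`. -/
noncomputable def dualObj {d k : ℕ} (Y : Matrix (Fin d) (Fin d) ℝ) (ν : Fin k → ℝ) : ℝ :=
  Y.trace + ∑ i, ν i

/-- Feasibility for the dual SDP (SDP-D). -/
def DualFeasible {d k : ℕ} (M : Fin k → Matrix (Fin d) (Fin d) ℝ)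
    (Y : Matrix (Fin d) (Fin d) ℝ) (Z : Fin k → Matrix (Fin d) (Fin d) ℝ)
    (ν : Fin k → ℝ) : Prop :=
  Y.PosSemidef ∧ (∀ i, (Z i).PosSemidef) ∧
    (∀ i, Y = M i + Z i - ν i • (1 : Matrix (Fin d) (Fin d) ℝ))

namespace Matrix

variable {n : Type*} [Fintype n]

theorem PosSemidef.trace_mul_nonneg [DecidableEq n] {A B : Matrix n n ℝ} (hA : A.PosSemidef)
    (hB : B.PosSemidef) : 0 ≤ (A * B).trace := by
  obtain ⟨C, rfl⟩ : ∃ C : Matrix n n ℝ, B = Cᴴ * C := by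
    open scoped MatrixOrder in
    exact CStarAlgebra.nonneg_iff_eq_star_mul_self.mp hB.nonneg
  rw [← Matrix.mul_assoc, trace_mul_comm, ← Matrix.mul_assoc]
  exact (hA.mul_mul_conjTranspose_same C).trace_nonneg

theorem isClosed_setOf_posSemidef : IsClosed {A : Matrix n n ℝ | A.PosSemidef} := by
  simp only [posSemidef_iff_dotProduct_mulVec, IsHermitian, Set.ofPred_and, Set.ofPred_forall]
  refine (isClosed_eq (by fun_prop) (by fun_prop)).inter (isClosed_iInter fun x => ?_)
  exact isClosed_le (by fun_prop) (by fun_prop)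

theorem PosSemidef.abs_apply_le_trace [DecidableEq n] {A : Matrix n n ℝ} (hA : A.PosSemidef) (i j : n) :
    |A i j| ≤ A.trace := by
  have hdiag : ∀ l, A l l ≤ A.trace := fun l =>
    Finset.single_le_sum (f := fun l => A l l) (fun _ _ => hA.diag_nonneg) (Finset.mem_univ l)
  have hsymm : A j i = A i j := by simpa using hA.isHermitian.apply i j
  have hadd := hA.dotProduct_mulVec_nonneg (Pi.single i 1 + Pi.single j 1)
  have hsub := hA.dotProduct_mulVec_nonneg (Pi.single i 1 - Pi.single j 1)
  simp [mulVec_add, mulVec_sub] at hadd hsub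
  have hi := hdiag i
  have hj := hdiag j
  rw [abs_le]
  constructor <;> linarith

theorem isCompact_setOf_posSemidef_trace_le [DecidableEq n] (R : ℝ) :
    IsCompact {A : Matrix n n ℝ | A.PosSemidef ∧ A.trace ≤ R} := by
  have hK : IsCompact (Set.univ.pi fun _ : n => Set.univ.pi fun _ : n => Set.Icc (-R) R) :=
    isCompact_univ_pi fun _ => isCompact_univ_pi fun _ => isCompact_Icc
  have hclosed : IsClosed {A : Matrix n n ℝ | A.trace ≤ R} :=
    isClosed_le (by fun_prop) (by fun_prop)
  refine hK.of_isClosed_subset (isClosed_setOf_posSemidef.inter hclosed) ?_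
  rintro A ⟨hA, hR⟩ i - j -
  exact abs_le.mp ((hA.abs_apply_le_trace i j).trans hR)

theorem convex_setOf_posSemidef_trace_le (R : ℝ) :
    Convex ℝ {A : Matrix n n ℝ | A.PosSemidef ∧ A.trace ≤ R} := by
  rintro A ⟨hA, hAR⟩ B ⟨hB, hBR⟩ a b ha hb hab
  refine ⟨(hA.smul ha).add (hB.smul hb), ?_⟩
  simp only [trace_add, trace_smul, smul_eq_mul]
  calc a * A.trace + b * B.trace ≤ a * R + b * R := by gcongr
    _ = R := by rw [← add_mul, hab, one_mul]

variable (n) in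
/-- The set of positive semidefinite real matrices of trace one. -/
def spectraplex : Set (Matrix n n ℝ) := {A | A.PosSemidef ∧ A.trace = 1}

theorem isCompact_spectraplex [DecidableEq n] : IsCompact (spectraplex n) :=
  (isCompact_setOf_posSemidef_trace_le 1).of_isClosed_subset
    (isClosed_setOf_posSemidef.inter (isClosed_eq (by fun_prop) (by fun_prop)))
    fun _ hA => ⟨hA.1, hA.2.le⟩

theorem convex_spectraplex : Convex ℝ (spectraplex n) := by
  rintro A ⟨hA, hA1⟩ B ⟨hB, hB1⟩ a b ha hb hab
  refine ⟨(hA.smul ha).add (hB.smul hb), ?_⟩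
  simp [hA1, hB1, hab]

theorem smul_vecMulVec_mem_spectraplex {x : n → ℝ} (hx : x ≠ 0) :
    (x ⬝ᵥ x)⁻¹ • vecMulVec x x ∈ spectraplex n := by
  have hpos : 0 < x ⬝ᵥ x := by simpa using dotProduct_star_self_pos_iff.mpr hx
  refine ⟨PosSemidef.smul ?_ (inv_nonneg.mpr hpos.le), ?_⟩
  · simpa using posSemidef_vecMulVec_self_star x
  · rw [trace_smul, trace_vecMulVec, smul_eq_mul, inv_mul_cancel₀ hpos.ne']

theorem spectraplex_nonempty [Nonempty n] : (spectraplex n).Nonempty :=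
  ⟨_, smul_vecMulVec_mem_spectraplex (x := 1) one_ne_zero⟩

/-- A symmetric matrix is positive semidefinite as soon as it pairs nonnegatively with every
element of the spectraplex. -/
theorem IsHermitian.posSemidef_of_forall_spectraplex {A : Matrix n n ℝ} (hA : A.IsHermitian)
    (h : ∀ P ∈ spectraplex n, 0 ≤ (A * P).trace) : A.PosSemidef := by
  refine .of_dotProduct_mulVec_nonneg hA fun x => ?_
  rcases eq_or_ne x 0 with rfl | hx
  · simp
  have hpos : 0 < x ⬝ᵥ x := by simpa using dotProduct_star_self_pos_iff.mpr hx
  have hP := h _ (smul_vecMulVec_mem_spectraplex hx)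
  rw [mul_smul_comm, trace_smul, mul_vecMulVec, trace_vecMulVec, smul_eq_mul] at hP
  rw [star_trivial, dotProduct_comm]
  exact nonneg_of_mul_nonneg_right hP (inv_pos.mpr hpos)

/-- Variational characterization of the least eigenvalue over the spectraplex. -/
theorem IsHermitian.exists_spectraplex_posSemidef_sub [DecidableEq n] [Nonempty n]
    {A : Matrix n n ℝ}
    (hA : A.IsHermitian) :
    ∃ P ∈ spectraplex n, (A - (A * P).trace • (1 : Matrix n n ℝ)).PosSemidef := by
  obtain ⟨P, hP, hmin⟩ := isCompact_spectraplex.exists_isMinOn (spectraplex_nonempty (n := n))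
    (f := fun P => (A * P).trace) (by fun_prop)
  refine ⟨P, hP, posSemidef_of_forall_spectraplex ?_ fun Q hQ => ?_⟩
  · exact hA.sub (by simp [IsHermitian])
  · have hle : (A * P).trace ≤ (A * Q).trace := hmin hQ
    simpa [sub_mul, hQ.2] using hle

theorem PosSemidef.le_trace_mul_spectraplex [DecidableEq n] {A P : Matrix n n ℝ} {m : ℝ}
    (h : (A - m • (1 : Matrix n n ℝ)).PosSemidef) (hP : P ∈ spectraplex n) :
    m ≤ (A * P).trace := by
  simpa [sub_mul, hP.2] using h.trace_mul_nonneg hP.1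

end Matrix

/-- The Lagrangian of (SDP-P) with respect to the constraint `∑ i, X i ≤ 1`. -/
noncomputable def sdpLagrangian {d k : ℕ} (M : Fin k → Matrix (Fin d) (Fin d) ℝ)
    (Y : Matrix (Fin d) (Fin d) ℝ) (X : Fin k → Matrix (Fin d) (Fin d) ℝ) : ℝ :=
  Y.trace + ∑ i, ((M i * X i).trace - (Y * X i).trace)

section

variable {d k : ℕ} {M : Fin k → Matrix (Fin d) (Fin d) ℝ}

theorem sdpLagrangian_eq_primalObj_add (Y : Matrix (Fin d) (Fin d) ℝ)
    (X : Fin k → Matrix (Fin d) (Fin d) ℝ) :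
    sdpLagrangian M Y X = primalObj M X + (Y * (1 - ∑ i, X i)).trace := by
  simp only [sdpLagrangian, primalObj, mul_sub, mul_one, trace_sub, Finset.mul_sum, trace_sum,
    Finset.sum_sub_distrib]
  ring

theorem sdpLagrangian_sub_smul_one (Y : Matrix (Fin d) (Fin d) ℝ)
    {X : Fin k → Matrix (Fin d) (Fin d) ℝ} (hX : ∀ i, X i ∈ spectraplex (Fin d)) (m : ℝ) :
    sdpLagrangian M (Y - m • 1) X = sdpLagrangian M Y X - m * (d - k) := by
  simp only [sdpLagrangian, sub_mul, trace_sub, smul_mul_assoc, one_mul, trace_smul, (hX _).2,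
    trace_one, Fintype.card_fin, Finset.sum_sub_distrib, Finset.sum_const, Finset.card_univ,
    smul_eq_mul, nsmul_eq_mul]
  ring

theorem exists_isSaddlePointOn_sdpLagrangian [NeZero d] {R : ℝ} (hR : 0 ≤ R) :
    ∃ Y ∈ {A : Matrix (Fin d) (Fin d) ℝ | A.PosSemidef ∧ A.trace ≤ R},
      ∃ X ∈ Set.univ.pi fun _ : Fin k => spectraplex (Fin d),
        IsSaddlePointOn {A | A.PosSemidef ∧ A.trace ≤ R}
          (Set.univ.pi fun _ => spectraplex (Fin d)) (sdpLagrangian M) Y X := by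
  have cT := convex_setOf_posSemidef_trace_le (n := Fin d) R
  have cS : Convex ℝ (Set.univ.pi fun _ : Fin k => spectraplex (Fin d)) :=
    convex_pi fun _ _ => convex_spectraplex
  refine Sion.exists_isSaddlePointOn ⟨0, .zero, by simpa using hR⟩ cT
    (isCompact_setOf_posSemidef_trace_le R) (fun X _ => ?_) (fun X _ => ?_) cS
    (Set.univ_pi_nonempty_iff.mpr fun _ => spectraplex_nonempty)
    (isCompact_univ_pi fun _ => isCompact_spectraplex) (fun Y _ => ?_) (fun Y _ => ?_)
  · refine Continuous.lowerSemicontinuous (by unfold sdpLagrangian; fun_prop)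
      |>.lowerSemicontinuousOn _
  · refine ConvexOn.quasiconvexOn ⟨cT, fun A _ B _ a b _ _ hab => le_of_eq ?_⟩
    simp only [sdpLagrangian, add_mul, trace_add, smul_mul_assoc, trace_smul, smul_eq_mul,
      Finset.sum_sub_distrib, Finset.sum_add_distrib, ← Finset.mul_sum]
    linear_combination -(∑ i, (M i * X i).trace) * hab
  · refine Continuous.upperSemicontinuous (by unfold sdpLagrangian; fun_prop)
      |>.upperSemicontinuousOn _
  · refine ConcaveOn.quasiconcaveOn ⟨cS, fun A _ B _ a b _ _ hab => le_of_eq ?_⟩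
    simp only [sdpLagrangian, mul_add, Pi.add_apply, Pi.smul_apply, trace_add, mul_smul_comm,
      trace_smul, smul_eq_mul, Finset.sum_sub_distrib, Finset.sum_add_distrib, ← Finset.mul_sum]
    linear_combination Y.trace * hab

theorem PrimalFeasible.primalObj_le_dualObj {X Z : Fin k → Matrix (Fin d) (Fin d) ℝ}
    {Y : Matrix (Fin d) (Fin d) ℝ} {ν : Fin k → ℝ} (hX : PrimalFeasible X)
    (hY : DualFeasible M Y Z ν) : primalObj M X ≤ dualObj Y ν := by
  obtain ⟨hX0, hX1, hXS⟩ := hX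
  obtain ⟨hY0, hZ0, hYZ⟩ := hY
  calc primalObj M X ≤ sdpLagrangian M Y X := by
        rw [sdpLagrangian_eq_primalObj_add]
        exact le_add_of_nonneg_right (hY0.trace_mul_nonneg hXS)
    _ ≤ dualObj Y ν := by
        refine add_le_add_right (Finset.sum_le_sum fun i _ => ?_) _
        have h := (hZ0 i).trace_mul_nonneg (hX0 i)
        rw [hYZ i]
        simp only [sub_mul, add_mul, trace_sub, trace_add, smul_mul_assoc, one_mul, trace_smul,
          hX1 i, smul_eq_mul]
        linarith

/-- The Lagrangian, with the dual variable ranging over a large enough trace ball, has a saddle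
point whose dual variable lies well inside that ball. -/
theorem exists_sdpLagrangian_saddle_trace_add_one_le [NeZero d] (hkd : k ≤ d)
    (hM : ∀ i, (M i).IsHermitian) :
    ∃ (R : ℝ) (Y : Matrix (Fin d) (Fin d) ℝ) (X : Fin k → Matrix (Fin d) (Fin d) ℝ),
      Y.PosSemidef ∧ Y.trace + 1 ≤ R ∧ (∀ i, X i ∈ spectraplex (Fin d)) ∧
      ∀ Y' X', Y'.PosSemidef → Y'.trace ≤ R → (∀ i, X' i ∈ spectraplex (Fin d)) →
        sdpLagrangian M Y X' ≤ sdpLagrangian M Y' X := by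
  choose P hP hMP using fun i => (hM i).exists_spectraplex_posSemidef_sub
  choose Q hQ hMQ using fun i => (hM i).neg.exists_spectraplex_posSemidef_sub
  have hlower i {W} (hW : W ∈ spectraplex (Fin d)) := (hMP i).le_trace_mul_spectraplex hW
  have hupper i {W} (hW : W ∈ spectraplex (Fin d)) : (M i * W).trace ≤ (M i * Q i).trace := by
    simpa using (hMQ i).le_trace_mul_spectraplex hW
  set R : ℝ := ∑ i, (M i * Q i).trace - ∑ i, (M i * P i).trace + 1 with hRdef
  have hR : 0 ≤ R := by
    have := Finset.sum_le_sum fun i (_ : i ∈ Finset.univ) => hupper i (hP i)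
    linarith
  obtain ⟨Y, ⟨hY, hYR⟩, X, hX, hsaddle⟩ :=
    exists_isSaddlePointOn_sdpLagrangian (M := M) (k := k) hR
  have hX : ∀ i, X i ∈ spectraplex (Fin d) := fun i => hX i trivial
  obtain ⟨W, hW, hYW⟩ := hY.isHermitian.exists_spectraplex_posSemidef_sub
  set m := (Y * W).trace with hm
  have hm0 : 0 ≤ m := hY.trace_mul_nonneg hW.1
  have hshift : ∀ Y' X', Y'.PosSemidef → Y'.trace ≤ R → (∀ i, X' i ∈ spectraplex (Fin d)) →
      sdpLagrangian M (Y - m • 1) X' ≤ sdpLagrangian M Y' X := by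
    intro Y' X' hY' hYR' hX'
    have hkd' : (0 : ℝ) ≤ d - k := sub_nonneg.mpr (by exact_mod_cast hkd)
    rw [sdpLagrangian_sub_smul_one _ hX']
    exact (sub_le_self _ (mul_nonneg hm0 hkd')).trans
      (hsaddle Y' ⟨hY', hYR'⟩ X' fun i _ => hX' i)
  refine ⟨R, Y - m • 1, X, hYW, ?_, hX, hshift⟩
  have hle := hshift 0 (fun _ => W) .zero (by simpa using hR) fun _ => hW
  have horth : ((Y - m • 1) * W).trace = 0 := by simp [sub_mul, hW.2, hm]
  simp only [sdpLagrangian, horth, sub_zero, trace_zero, zero_mul, zero_add] at hle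
  have h1 := Finset.sum_le_sum fun i (_ : i ∈ Finset.univ) => hlower i hW
  have h2 := Finset.sum_le_sum fun i (_ : i ∈ Finset.univ) => hupper i (hX i)
  linarith

end

/-- **Strong duality** for (SDP-P)/(SDP-D): there are a primal feasible tuple maximizing the
primal objective and a dual feasible tuple minimizing the dual objective, whose objective
values coincide.  (Hence the primal supremum equals the dual infimum, and both are attained.) -/
theorem strong_duality {d k : ℕ} (hk : 1 ≤ k) (hkd : k ≤ d)
    (M : Fin k → Matrix (Fin d) (Fin d) ℝ) (hM : ∀ i, (M i).IsHermitian) :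
    ∃ (X : Fin k → Matrix (Fin d) (Fin d) ℝ) (Y : Matrix (Fin d) (Fin d) ℝ)
      (Z : Fin k → Matrix (Fin d) (Fin d) ℝ) (ν : Fin k → ℝ),
      PrimalFeasible X ∧ DualFeasible M Y Z ν ∧
      (∀ X', PrimalFeasible X' → primalObj M X' ≤ primalObj M X) ∧
      (∀ Y' Z' ν', DualFeasible M Y' Z' ν' → dualObj Y ν ≤ dualObj Y' ν') ∧
      primalObj M X = dualObj Y ν := by
  have : NeZero d := ⟨by omega⟩
  obtain ⟨R, Y, X, hY, hYR, hX, hsaddle⟩ := exists_sdpLagrangian_saddle_trace_add_one_le hkd hM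
  have hpair : ∀ Y', Y'.PosSemidef → Y'.trace ≤ R →
      (Y * (1 - ∑ i, X i)).trace ≤ (Y' * (1 - ∑ i, X i)).trace := by
    intro Y' hY' hYR'
    simpa only [sdpLagrangian_eq_primalObj_add, add_le_add_iff_left] using
      hsaddle Y' X hY' hYR' hX
  have hslack : (1 - ∑ i, X i).PosSemidef := by
    refine IsHermitian.posSemidef_of_forall_spectraplex ?_ fun P hP => ?_
    · exact isHermitian_one.sub (posSemidef_sum _ fun i _ => (hX i).1).isHermitian
    · have h := hpair (Y + P) (hY.add hP.1) (by rw [trace_add, hP.2]; exact hYR)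
      rw [add_mul, trace_add] at h
      rw [trace_mul_comm]
      linarith
  have hcompl : (Y * (1 - ∑ i, X i)).trace ≤ 0 := by
    simpa using hpair 0 .zero (by rw [trace_zero]; linarith [hY.trace_nonneg])
  choose V hV hYV using fun i => (hY.isHermitian.sub (hM i)).exists_spectraplex_posSemidef_sub
  have hXf : PrimalFeasible X := ⟨fun i => (hX i).1, fun i => (hX i).2, hslack⟩
  have hYf : DualFeasible M Y (fun i => Y - M i - ((Y - M i) * V i).trace • 1)
      (fun i => -((Y - M i) * V i).trace) :=
    ⟨hY, hYV, fun i => by module⟩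
  have hdual : dualObj Y (fun i => -((Y - M i) * V i).trace) = sdpLagrangian M Y V := by
    simp [dualObj, sdpLagrangian, sub_mul]
  have heq : primalObj M X = dualObj Y (fun i => -((Y - M i) * V i).trace) := by
    refine (hXf.primalObj_le_dualObj hYf).antisymm ?_
    have h := hsaddle Y V hY (by linarith) hV
    rw [sdpLagrangian_eq_primalObj_add Y X] at h
    linarith
  exact ⟨X, Y, _, _, hXf, hYf, fun X' hX' => heq ▸ hX'.primalObj_le_dualObj hYf,
    fun Y' Z' ν' hY' => heq ▸ hXf.primalObj_le_dualObj hY', heq⟩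
end

section
/- Let (X̄_1,...,X̄_k) be a primal optimal solution of (SDP-P). Then each X̄_i has rank one if and only if there exists Ū ∈ St(k,d), with columns ū_1,...,ū_k, such that X̄_i = ū_i ū_iᵀ for all i and Ū attains the maximum of Σ_{i=1}^k u_iᵀ M_i u_i over St(k,d); in that case the optimal value of (SDP-P) equals the maximum of Σ_{i=1}^k u_iᵀ M_i u_i over St(k,d). -/
open Matrix

/-- Membership in the Stiefel manifold St(k,d): `UᵀU = I`. -/
def Stiefel {d k : ℕ} (U : Matrix (Fin d) (Fin k) ℝ) : Prop :=
  Uᵀ * U = 1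

/-- The `i`-th column of `U` as a vector of `ℝ^d`. -/
def colVec {d k : ℕ} (U : Matrix (Fin d) (Fin k) ℝ) (i : Fin k) : Fin d → ℝ :=
  fun a => U a i

/-- The objective `∑ i, uᵢᵀ M_i uᵢ` of the nonconvex problem on the Stiefel manifold. -/
noncomputable def stObj {d k : ℕ} (M : Fin k → Matrix (Fin d) (Fin d) ℝ)
    (U : Matrix (Fin d) (Fin k) ℝ) : ℝ :=
  ∑ i, colVec U i ⬝ᵥ (M i *ᵥ colVec U i)

/-- A real positive semidefinite matrix of rank one is `u uᵀ` for some vector `u`. -/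
lemma exists_eq_vecMulVec_self_of_rank_eq_one {n : Type*} [Fintype n] [DecidableEq n]
    {A : Matrix n n ℝ} (hA : A.PosSemidef) (hr : A.rank = 1) :
    ∃ u : n → ℝ, A = vecMulVec u u := by
  have hsymm : ∀ i j, A i j = A j i := fun i j => by simpa using (hA.isHermitian.apply i j).symm
  obtain ⟨a, b, hab⟩ : ∃ a b : n → ℝ, A = vecMulVec a b := by
    rw [rank_eq_finrank_span_cols] at hr
    obtain ⟨v, -, hv⟩ := finrank_eq_one_iff'.mp hr
    choose c hc using fun j => hv ⟨A.col j, Submodule.subset_span ⟨j, rfl⟩⟩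
    refine ⟨v, c, ?_⟩
    ext i j
    simpa [mul_comm, vecMulVec_apply] using (congrFun (congrArg Subtype.val (hc j)) i).symm
  have hA0 : A ≠ 0 := by
    rintro rfl
    simp at hr
  have htr : A.trace ≠ 0 := fun h => hA0 (hA.trace_eq_zero_iff.mp h)
  obtain ⟨i, -, hi⟩ := Finset.exists_ne_zero_of_sum_ne_zero htr
  have hpos : 0 < A i i := lt_of_le_of_ne hA.diag_nonneg (Ne.symm hi)
  refine ⟨fun j => A j i / √(A i i), ?_⟩
  ext j l
  have hji := hsymm i l
  have hsq : √(A i i) * √(A i i) = A i i := Real.mul_self_sqrt hpos.le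
  rw [vecMulVec_apply, div_mul_div_comm, hsq, eq_div_iff hpos.ne', ← hji]
  simp only [hab, vecMulVec_apply]
  ring

lemma rank_vecMulVec_eq_one {n : Type*} [Fintype n] [DecidableEq n] {u : n → ℝ}
    (hu : u ≠ 0) : (vecMulVec u u).rank = 1 := by
  refine le_antisymm (rank_vecMulVec_le u u) (Nat.one_le_iff_ne_zero.mpr fun h => hu ?_)
  rw [Matrix.rank, Submodule.finrank_eq_zero, LinearMap.range_eq_bot] at h
  simpa [vecMulVec_mulVec] using LinearMap.congr_fun h u

lemma stiefel_iff {d k : ℕ} {U : Matrix (Fin d) (Fin k) ℝ} :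
    Stiefel U ↔ ∀ i j, colVec U i ⬝ᵥ colVec U j = if i = j then 1 else 0 :=
  Matrix.ext_iff.symm

lemma sum_vecMulVec_colVec {d k : ℕ} (U : Matrix (Fin d) (Fin k) ℝ) :
    ∑ i, vecMulVec (colVec U i) (colVec U i) = U * Uᵀ := by
  ext a b
  simp [Matrix.sum_apply, vecMulVec_apply, colVec, Matrix.mul_apply]

lemma primalObj_vecMulVec {d k : ℕ} (M : Fin k → Matrix (Fin d) (Fin d) ℝ)
    (U : Matrix (Fin d) (Fin k) ℝ) :
    primalObj M (fun i => vecMulVec (colVec U i) (colVec U i)) = stObj M U := by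
  simp only [primalObj, stObj, mul_vecMulVec, trace_vecMulVec]
  exact Finset.sum_congr rfl fun i _ => dotProduct_comm _ _

lemma Stiefel.primalFeasible {d k : ℕ} {U : Matrix (Fin d) (Fin k) ℝ} (hU : Stiefel U) :
    PrimalFeasible (fun i => vecMulVec (colVec U i) (colVec U i)) := by
  refine ⟨fun i => by simpa using posSemidef_vecMulVec_self_star (colVec U i),
    fun i => by simp [trace_vecMulVec, stiefel_iff.mp hU i i], ?_⟩
  rw [sum_vecMulVec_colVec]
  have hproj : (1 - U * Uᵀ) = (1 - U * Uᵀ)ᴴ * (1 - U * Uᵀ) := by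
    have hidem : U * Uᵀ * (U * Uᵀ) = U * Uᵀ := by
      rw [Matrix.mul_assoc, ← Matrix.mul_assoc Uᵀ, show Uᵀ * U = 1 from hU, Matrix.one_mul]
    simp [Matrix.sub_mul, Matrix.mul_sub, hidem]
  rw [hproj]
  exact posSemidef_conjTranspose_mul_self _

lemma PrimalFeasible.stiefel {d k : ℕ} {U : Matrix (Fin d) (Fin k) ℝ}
    (hU : PrimalFeasible (fun i => vecMulVec (colVec U i) (colVec U i))) : Stiefel U := by
  obtain ⟨-, htr, hle⟩ := hU
  have hone : ∀ i, colVec U i ⬝ᵥ colVec U i = 1 := fun i => by simpa [trace_vecMulVec] using htr i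
  refine stiefel_iff.mpr fun i j => ?_
  split_ifs with hij
  · exact hij ▸ hone i
  have hsum : ∑ l, (colVec U i ⬝ᵥ colVec U l) ^ 2 ≤ 1 := by
    have h := hle.dotProduct_mulVec_nonneg (colVec U i)
    simp only [star_trivial, sub_mulVec, one_mulVec, sum_mulVec, dotProduct_sub, dotProduct_sum,
      vecMulVec_mulVec, hone, dotProduct_smul] at h
    refine (Finset.sum_le_sum fun l _ => ?_).trans (sub_nonneg.mp h)
    simp [dotProduct_comm (colVec U l), sq]
  have hpair : (colVec U i ⬝ᵥ colVec U i) ^ 2 + (colVec U i ⬝ᵥ colVec U j) ^ 2 ≤ 1 := by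
    rw [← Finset.sum_pair (f := fun l => (colVec U i ⬝ᵥ colVec U l) ^ 2) hij]
    exact (Finset.sum_le_univ_sum_of_nonneg fun l => sq_nonneg _).trans hsum
  rw [hone] at hpair
  exact pow_eq_zero_iff two_ne_zero |>.mp (le_antisymm (by linarith) (sq_nonneg _))

/-- An optimal solution of (SDP-P) has all `X i` of rank one iff it comes from a global
maximizer of the nonconvex problem on the Stiefel manifold; in that case the optimal value
of (SDP-P) equals the maximum of the Stiefel objective. -/
theorem sdp_tight_iff_rank_one {d k : ℕ} (hk : 1 ≤ k) (hkd : k ≤ d)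
    (M : Fin k → Matrix (Fin d) (Fin d) ℝ) (hM : ∀ i, (M i).IsHermitian)
    (X : Fin k → Matrix (Fin d) (Fin d) ℝ) (hfeas : PrimalFeasible X)
    (hopt : ∀ X', PrimalFeasible X' → primalObj M X' ≤ primalObj M X) :
    ((∀ i, (X i).rank = 1) ↔
      ∃ U : Matrix (Fin d) (Fin k) ℝ, Stiefel U ∧
        (∀ i, X i = vecMulVec (colVec U i) (colVec U i)) ∧
        (∀ V : Matrix (Fin d) (Fin k) ℝ, Stiefel V → stObj M V ≤ stObj M U)) ∧
    ((∀ i, (X i).rank = 1) →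
      ∀ U : Matrix (Fin d) (Fin k) ℝ, Stiefel U →
        (∀ V : Matrix (Fin d) (Fin k) ℝ, Stiefel V → stObj M V ≤ stObj M U) →
        primalObj M X = stObj M U) := by
  have hexists : (∀ i, (X i).rank = 1) → ∃ U : Matrix (Fin d) (Fin k) ℝ, Stiefel U ∧
      X = fun i => vecMulVec (colVec U i) (colVec U i) := by
    intro hr
    choose u hu using fun i => exists_eq_vecMulVec_self_of_rank_eq_one (hfeas.1 i) (hr i)
    have hX : X = fun i => vecMulVec (colVec (of u)ᵀ i) (colVec (of u)ᵀ i) := funext hu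
    exact ⟨(of u)ᵀ, PrimalFeasible.stiefel (hX ▸ hfeas), hX⟩
  have hbound : ∀ V : Matrix (Fin d) (Fin k) ℝ, Stiefel V → stObj M V ≤ primalObj M X :=
    fun V hV => primalObj_vecMulVec M V ▸ hopt _ hV.primalFeasible
  refine ⟨⟨fun hr => ?_, ?_⟩, fun hr U hU hmax => ?_⟩
  · obtain ⟨U, hU, hX⟩ := hexists hr
    refine ⟨U, hU, congrFun hX, fun V hV => ?_⟩
    rw [← primalObj_vecMulVec M U, ← hX]
    exact hbound V hV
  · rintro ⟨U, hU, hX, -⟩ i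
    rw [hX i]
    refine rank_vecMulVec_eq_one fun h0 => ?_
    simpa [h0] using stiefel_iff.mp hU i i
  · obtain ⟨U₀, hU₀, hX⟩ := hexists hr
    refine le_antisymm ?_ (hbound U hU)
    rw [hX, primalObj_vecMulVec]
    exact hmax U₀ hU₀
end

section
/- Fix μ > 0 and let M̄_1,...,M̄_k be real symmetric d×d matrices with 0 ⪯ M̄_i ⪯ μI_d that are jointly diagonalizable, i.e., there exists an orthogonal matrix Q ∈ ℝ^{d×d} such that Qᵀ M̄_i Q is diagonal for every i. Suppose the primal SDP (SDP-P) with data (M̄_1,...,M̄_k) has a unique primal optimal solution. Then there exists ε > 0 such that for every k-tuple (M_1,...,M_k) of real symmetric d×d matrices with 0 ⪯ M_i ⪯ μI_d for all i and max_{i∈[k]} ‖M_i − M̄_i‖ < ε (spectral norm), every primal optimal solution (X_1,...,X_k) of (SDP-P) with data (M_1,...,M_k) satisfies rank(X_i) = 1 for all i. -/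
open Matrix

/-- The spectral norm (ℓ²-operator norm, i.e. largest singular value) of a matrix. -/
noncomputable def specNorm {d : ℕ} (A : Matrix (Fin d) (Fin d) ℝ) : ℝ :=
  ‖Matrix.toEuclideanCLM (𝕜 := ℝ) A‖

/-- A matrix with nonnegative entries, row sums one and column sums at most one extends to a
doubly stochastic matrix, so linear functionals on such matrices are bounded by their values at
injective assignments. -/
theorem sum_mul_le_of_forall_injective {d k : ℕ} (hkd : k ≤ d) (A w : Fin k → Fin d → ℝ) (B : ℝ)
    (hA : ∀ i j, 0 ≤ A i j) (hrow : ∀ i, ∑ j, A i j = 1) (hcol : ∀ j, ∑ i, A i j ≤ 1)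
    (hB : ∀ σ : Fin k → Fin d, Function.Injective σ → ∑ i, w i (σ i) ≤ B) :
    ∑ i, ∑ j, A i j * w i j ≤ B := by
  obtain ⟨m, rfl⟩ := Nat.exists_eq_add_of_le hkd
  let A' : Matrix (Fin (k + m)) (Fin (k + m)) ℝ :=
    fun a j => Fin.addCases (fun i => A i j) (fun _ => (1 - ∑ i, A i j) / m) a
  have hA'l : ∀ i j, A' (Fin.castAdd m i) j = A i j := fun i j => by simp [A']
  have hA'r : ∀ i j, A' (Fin.natAdd k i) j = (1 - ∑ i, A i j) / m := fun i j => by simp [A']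
  have htot : ∑ j, (1 - ∑ i, A i j) = m := by
    rw [Finset.sum_sub_distrib, Finset.sum_comm]
    simp [hrow]
  have hA' : A' ∈ doublyStochastic ℝ (Fin (k + m)) := by
    rw [mem_doublyStochastic_iff_sum]
    refine ⟨fun a j => ?_, fun a => ?_, fun j => ?_⟩
    · refine Fin.addCases (fun i => ?_) (fun i => ?_) a
      · rw [hA'l]; exact hA i j
      · rw [hA'r]; exact div_nonneg (by linarith [hcol j]) (Nat.cast_nonneg m)
    · refine Fin.addCases (fun i => ?_) (fun i => ?_) a
      · simp only [hA'l]; exact hrow i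
      · have hm : (m : ℝ) ≠ 0 := Nat.cast_ne_zero.2 (Fin.pos i).ne'
        simp only [hA'r]
        rw [← Finset.sum_div, htot, div_self hm]
    · rw [Fin.sum_univ_add]
      simp only [hA'l, hA'r, Finset.sum_const, Finset.card_univ, Fintype.card_fin, nsmul_eq_mul]
      rcases eq_or_ne (m : ℝ) 0 with hm | hm
      · rw [hm] at htot
        have := (Finset.sum_eq_zero_iff_of_nonneg
          (fun j _ => by linarith [hcol j])).1 htot j (Finset.mem_univ j)
        rw [hm]; linarith
      · field_simp; ring
  have hconv : Convex ℝ {N : Matrix (Fin (k + m)) (Fin (k + m)) ℝ |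
      ∑ i, ∑ j, N (Fin.castAdd m i) j * w i j ≤ B} := by
    refine convex_halfSpace_le (f := fun N : Matrix (Fin (k + m)) (Fin (k + m)) ℝ =>
      ∑ i, ∑ j, N (Fin.castAdd m i) j * w i j) ⟨fun N N' => ?_, fun c N => ?_⟩ B
    · simp [add_mul, Finset.sum_add_distrib]
    · simp [mul_assoc, Finset.mul_sum]
  have hmem : A' ∈ (doublyStochastic ℝ (Fin (k + m)) : Set (Matrix _ _ ℝ)) := hA'
  rw [doublyStochastic_eq_convexHull_permMatrix] at hmem
  have := convexHull_min (by
    rintro _ ⟨σ, rfl⟩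
    have := hB (fun i => σ (Fin.castAdd m i))
      (σ.injective.comp (Fin.castAdd_injective k m))
    simpa [Equiv.toPEquiv_apply] using this) hconv hmem
  simpa only [Set.mem_ofPred_eq, hA'l] using this

/-- The tuple of diagonal coordinate projections selected by `τ`. -/
noncomputable def coordProj {d k : ℕ} (τ : Fin k → Fin d) : Fin k → Matrix (Fin d) (Fin d) ℝ :=
  fun i => diagonal (Pi.single (τ i) 1)

/-- Simultaneous conjugation of a tuple of matrices. -/
def conjTuple {d k : ℕ} (U : Matrix (Fin d) (Fin d) ℝ) (X : Fin k → Matrix (Fin d) (Fin d) ℝ) :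
    Fin k → Matrix (Fin d) (Fin d) ℝ :=
  fun i => Uᵀ * X i * U

theorem coordProj_feasible {d k : ℕ} {τ : Fin k → Fin d} (hτ : Function.Injective τ) :
    PrimalFeasible (coordProj τ) := by
  refine ⟨fun i => PosSemidef.diagonal fun j => ?_, fun i => ?_, ?_⟩
  · by_cases h : j = τ i <;> simp [h]
  · simp [coordProj, trace_diagonal]
  · have : (1 : Matrix (Fin d) (Fin d) ℝ) - ∑ i, coordProj τ i =
        diagonal (fun j => 1 - ∑ i, Pi.single (M := fun _ => ℝ) (τ i) 1 j) := by
      ext a b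
      simp only [Matrix.sub_apply, Matrix.sum_apply, coordProj, diagonal_apply, one_apply]
      split_ifs <;> simp
    rw [this]
    refine PosSemidef.diagonal fun j => ?_
    simp only [Pi.zero_apply, Pi.single_apply, sub_nonneg]
    rw [Finset.sum_boole]
    exact_mod_cast Finset.card_le_one.2 fun a ha b hb => hτ <| by
      simp only [Finset.mem_filter] at ha hb
      rw [← ha.2, ← hb.2]

theorem primalObj_coordProj {d k : ℕ} (M : Fin k → Matrix (Fin d) (Fin d) ℝ) (τ : Fin k → Fin d) :
    primalObj M (coordProj τ) = ∑ i, M i (τ i) (τ i) := by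
  simp [primalObj, coordProj, trace, Pi.single_apply]

theorem primalObj_sub_right {d k : ℕ} (M X Y : Fin k → Matrix (Fin d) (Fin d) ℝ) :
    primalObj M (X - Y) = primalObj M X - primalObj M Y := by
  simp [primalObj, mul_sub]

theorem primalObj_sub_left {d k : ℕ} (M N X : Fin k → Matrix (Fin d) (Fin d) ℝ) :
    primalObj (M - N) X = primalObj M X - primalObj N X := by
  simp [primalObj, sub_mul]

theorem primalObj_le_of_entry_le {d k : ℕ} (M X : Fin k → Matrix (Fin d) (Fin d) ℝ) (r : ℝ)
    (hX : ∀ i a b, |X i a b| ≤ r) : primalObj M X ≤ (∑ i, ∑ a, ∑ b, |M i a b|) * r := by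
  simp only [primalObj, trace, diag_apply, mul_apply, Finset.sum_mul]
  refine Finset.sum_le_sum fun i _ => Finset.sum_le_sum fun a _ => Finset.sum_le_sum fun b _ => ?_
  calc M i a b * X i b a ≤ |M i a b * X i b a| := le_abs_self _
    _ = |M i a b| * |X i b a| := abs_mul _ _
    _ ≤ |M i a b| * r := by gcongr; exact hX i b a

theorem conjTuple_conjTuple_transpose {d k : ℕ} {U : Matrix (Fin d) (Fin d) ℝ} (hU : Uᵀ * U = 1)
    (X : Fin k → Matrix (Fin d) (Fin d) ℝ) : conjTuple U (conjTuple Uᵀ X) = X := by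
  funext i
  simp only [conjTuple, transpose_transpose, Matrix.mul_assoc]
  rw [hU, ← Matrix.mul_assoc, hU]
  simp

theorem primalObj_conjTuple {d k : ℕ} {U : Matrix (Fin d) (Fin d) ℝ} (hU : Uᵀ * U = 1)
    (M X : Fin k → Matrix (Fin d) (Fin d) ℝ) :
    primalObj (conjTuple U M) (conjTuple U X) = primalObj M X := by
  have hU' : U * Uᵀ = 1 := mul_eq_one_comm.1 hU
  refine Finset.sum_congr rfl fun i _ => ?_
  have : conjTuple U M i * conjTuple U X i = Uᵀ * (M i * X i) * U := by
    simp only [conjTuple]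
    calc Uᵀ * M i * U * (Uᵀ * X i * U) = Uᵀ * M i * (U * Uᵀ) * X i * U := by
          simp only [Matrix.mul_assoc]
      _ = _ := by rw [hU', Matrix.mul_one]; simp only [Matrix.mul_assoc]
  rw [this, trace_mul_cycle, hU', Matrix.one_mul]

theorem PrimalFeasible.conjTuple {d k : ℕ} {U : Matrix (Fin d) (Fin d) ℝ} (hU : Uᵀ * U = 1)
    {X : Fin k → Matrix (Fin d) (Fin d) ℝ} (hX : PrimalFeasible X) :
    PrimalFeasible (conjTuple U X) := by
  have hU' : U * Uᵀ = 1 := mul_eq_one_comm.1 hU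
  refine ⟨fun i => ?_, fun i => ?_, ?_⟩
  · simpa [_root_.conjTuple] using (hX.1 i).conjTranspose_mul_mul_same U
  · rw [_root_.conjTuple, trace_mul_cycle, hU', Matrix.one_mul, hX.2.1 i]
  · have := hX.2.2.conjTranspose_mul_mul_same U
    simpa [_root_.conjTuple, Matrix.mul_sub, Matrix.sub_mul, hU, Finset.mul_sum,
      Finset.sum_mul] using this

/-- Optimality in (SDP-P). -/
def PrimalOptimal {d k : ℕ} (M X : Fin k → Matrix (Fin d) (Fin d) ℝ) : Prop :=
  PrimalFeasible X ∧ ∀ X', PrimalFeasible X' → primalObj M X' ≤ primalObj M X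

theorem PrimalOptimal.conjTuple {d k : ℕ} {U : Matrix (Fin d) (Fin d) ℝ} (hU : Uᵀ * U = 1)
    {M X : Fin k → Matrix (Fin d) (Fin d) ℝ} (hX : PrimalOptimal M X) :
    PrimalOptimal (conjTuple U M) (conjTuple U X) := by
  have hU' : Uᵀᵀ * Uᵀ = 1 := mul_eq_one_comm.1 hU
  refine ⟨hX.1.conjTuple hU, fun X' hX' => ?_⟩
  rw [← conjTuple_conjTuple_transpose hU X', primalObj_conjTuple hU, primalObj_conjTuple hU]
  exact hX.2 _ (hX'.conjTuple hU')

/-- For diagonal data with a unique optimal solution, that solution is a tuple of coordinate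
projections and the optimum is sharp. -/
theorem exists_sharp_of_isDiag {d k : ℕ} (hkd : k ≤ d) (D : Fin k → Matrix (Fin d) (Fin d) ℝ)
    (hD : ∀ i, (D i).IsDiag)
    (huniq : ∀ X Y, PrimalOptimal D X → PrimalOptimal D Y → X = Y) :
    ∃ τ : Fin k → Fin d, Function.Injective τ ∧ ∃ c > 0, ∀ Y, PrimalFeasible Y →
      primalObj D Y ≤ primalObj D (coordProj τ) - c * ∑ i, (1 - Y i (τ i) (τ i)) := by
  classical
  have hobj : ∀ Y, primalObj D Y = ∑ i, ∑ j, Y i j j * D i j j := fun Y => by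
    refine Finset.sum_congr rfl fun i _ => Finset.sum_congr rfl fun j _ => ?_
    rw [diag_apply, mul_apply, Finset.sum_eq_single j, mul_comm]
    · intro b _ hb
      rw [hD i hb.symm, zero_mul]
    · simp
  have hLP : ∀ (w : Fin k → Fin d → ℝ) (B : ℝ),
      (∀ σ : Fin k → Fin d, Function.Injective σ → ∑ i, w i (σ i) ≤ B) →
      ∀ Y : Fin k → Matrix (Fin d) (Fin d) ℝ, PrimalFeasible Y →
        ∑ i, ∑ j, Y i j j * w i j ≤ B := by
    intro w B hB Y hY
    refine sum_mul_le_of_forall_injective hkd (fun i j => Y i j j) w B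
      (fun i j => (hY.1 i).diag_nonneg) (fun i => hY.2.1 i) (fun j => ?_) hB
    have := hY.2.2.diag_nonneg (i := j)
    rw [Matrix.sub_apply, Matrix.sum_apply, one_apply_eq] at this
    linarith
  obtain ⟨τ, hτ, hmax⟩ := Finset.exists_max_image
    (Finset.univ.filter fun σ : Fin k → Fin d => Function.Injective σ)
    (fun σ => ∑ i, D i (σ i) (σ i)) ⟨Fin.castLE hkd, by simp [Fin.castLE_injective]⟩
  simp only [Finset.mem_filter, Finset.mem_univ, true_and] at hτ hmax
  have hopt : ∀ σ : Fin k → Fin d, Function.Injective σ →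
      ∑ i, D i (τ i) (τ i) ≤ ∑ i, D i (σ i) (σ i) → PrimalOptimal D (coordProj σ) := by
    refine fun σ hσ h => ⟨coordProj_feasible hσ, fun X hX => ?_⟩
    rw [primalObj_coordProj, hobj]
    exact (hLP _ _ hmax X hX).trans h
  have hgap : ∀ σ : Fin k → Fin d, Function.Injective σ → σ ≠ τ →
      ∑ i, D i (σ i) (σ i) < ∑ i, D i (τ i) (τ i) := by
    intro σ hσ hne
    by_contra! h
    refine hne (funext fun i => ?_)
    have := congr_fun (congr_fun (congr_fun
      (huniq _ _ (hopt σ hσ h) (hopt τ hτ le_rfl)) i) (σ i)) (σ i)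
    by_contra hi
    simp [coordProj, hi] at this
  have hc : ∀ᶠ c : ℝ in nhdsWithin 0 (Set.Ioi 0), ∀ σ : Fin k → Fin d, Function.Injective σ →
      ∑ i, (D i (σ i) (σ i) + c * (if σ i = τ i then 0 else 1)) ≤ ∑ i, D i (τ i) (τ i) := by
    refine Filter.eventually_all.2 fun σ => ?_
    by_cases hσ : Function.Injective σ
    · by_cases hne : σ = τ
      · subst hne; simp
      · have hcont : Continuous fun c : ℝ =>
            ∑ i, (D i (σ i) (σ i) + c * (if σ i = τ i then 0 else 1)) := by fun_prop
        have := (hcont.tendsto 0).mono_left (nhdsWithin_le_nhds (s := Set.Ioi 0))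
        refine (this.eventually_lt_const (u := ∑ i, D i (τ i) (τ i)) ?_).mono fun c h _ => h.le
        simpa using hgap σ hσ hne
    · exact Filter.Eventually.of_forall fun c h => absurd h hσ
  obtain ⟨c, hcσ, hc0⟩ := (hc.and self_mem_nhdsWithin).exists
  refine ⟨τ, hτ, c, hc0, fun Y hY => ?_⟩
  have := hLP (fun i j => D i j j + c * (if j = τ i then 0 else 1)) _ hcσ Y hY
  rw [primalObj_coordProj, hobj, Finset.mul_sum, le_sub_iff_add_le, ← Finset.sum_add_distrib]
  refine le_trans (le_of_eq (Finset.sum_congr rfl fun i _ => ?_)) this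
  have htr : ∑ j, Y i j j = 1 := hY.2.1 i
  simp only [mul_add, Finset.sum_add_distrib]
  congr 1
  have : ∀ j, Y i j j * (c * (if j = τ i then 0 else 1)) =
      c * Y i j j - c * (if j = τ i then Y i j j else 0) := fun j => by split_ifs <;> ring
  simp only [this, Finset.sum_sub_distrib, ← Finset.mul_sum, htr]
  simp [mul_sub]

theorem abs_entry_le_of_posSemidef {d : ℕ} {P : Matrix (Fin d) (Fin d) ℝ} (hP : P.PosSemidef)
    (a b : Fin d) : |P a b| ≤ (P a a + P b b) / 2 := by
  have hsymm : P b a = P a b := by simpa using hP.1.apply a b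
  have h1 := hP.dotProduct_mulVec_nonneg (Pi.single a 1 + Pi.single b 1)
  have h2 := hP.dotProduct_mulVec_nonneg (Pi.single a 1 - Pi.single b 1)
  simp [mulVec_add, mulVec_sub, add_dotProduct, sub_dotProduct, dotProduct_add,
    dotProduct_sub] at h1 h2
  rw [abs_le]
  constructor <;> linarith

theorem abs_entry_le_one_of_feasible {d k : ℕ} {X : Fin k → Matrix (Fin d) (Fin d) ℝ}
    (hX : PrimalFeasible X) (i : Fin k) (a b : Fin d) : |X i a b| ≤ 1 := by
  have hdiag : ∀ c, X i c c ≤ 1 := fun c => by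
    rw [← hX.2.1 i]
    exact Finset.single_le_sum (f := fun c => X i c c) (fun c _ => (hX.1 i).diag_nonneg)
      (Finset.mem_univ c)
  linarith [abs_entry_le_of_posSemidef (hX.1 i) a b, hdiag a, hdiag b]

theorem linear_coeff_eq_zero_of_nonneg {B K L N : ℝ}
    (h : ∀ t : ℝ, 0 ≤ t * B + t ^ 2 * K + t ^ 3 * L + t ^ 4 * N) : B = 0 := by
  have hmin : IsLocalMin (fun t : ℝ => t * B + t ^ 2 * K + t ^ 3 * L + t ^ 4 * N) 0 :=
    Filter.Eventually.of_forall fun t => by simpa using h t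
  refine hmin.hasDerivAt_eq_zero ?_
  have := ((((hasDerivAt_id (0 : ℝ)).mul_const B).add
    (((hasDerivAt_id (0 : ℝ)).pow 2).mul_const K)).add
    (((hasDerivAt_id (0 : ℝ)).pow 3).mul_const L)).add
    (((hasDerivAt_id (0 : ℝ)).pow 4).mul_const N)
  exact (this.congr_deriv (by simp)).congr_of_eventuallyEq (.of_forall fun t => by simp)

/-- Comparing with Householder reflections gives a first-order condition for a tuple whose
selected diagonal mass is maximal on its orthogonal orbit. -/
theorem reflection_inequality {d k : ℕ} {X : Fin k → Matrix (Fin d) (Fin d) ℝ}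
    (hsymm : ∀ i, (X i)ᵀ = X i) (τ : Fin k → Fin d)
    (hmax : ∀ U : Matrix (Fin d) (Fin d) ℝ, Uᵀ * U = 1 →
      ∑ i, conjTuple U X i (τ i) (τ i) ≤ ∑ i, X i (τ i) (τ i))
    (w : Fin d → ℝ) :
    ∑ i, w (τ i) ^ 2 * (w ⬝ᵥ X i *ᵥ w) ≤ (w ⬝ᵥ w) * ∑ i, w (τ i) * (X i *ᵥ w) (τ i) := by
  rcases eq_or_ne w 0 with rfl | hw
  · simp
  have hpos : 0 < w ⬝ᵥ w := by
    refine lt_of_le_of_ne (Finset.sum_nonneg fun i _ => mul_self_nonneg _) fun h => hw ?_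
    exact dotProduct_self_eq_zero.1 h.symm
  set q := w ⬝ᵥ w with hq
  let H : Matrix (Fin d) (Fin d) ℝ := 1 - (2 / q) • vecMulVec w w
  have hHt : Hᵀ = H := by simp [H, transpose_vecMulVec]
  have hvv : vecMulVec w w * vecMulVec w w = q • vecMulVec w w := by
    rw [vecMulVec_mul_vecMulVec, ← hq]
    ext; simp [vecMulVec_apply]; ring
  have hH : Hᵀ * H = 1 := by
    rw [hHt]
    simp only [H, Matrix.sub_mul, Matrix.mul_sub, Matrix.one_mul, Matrix.mul_one,
      Matrix.smul_mul, Matrix.mul_smul, hvv, smul_smul]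
    have : 2 / q * q = 1 + 1 := by field_simp; norm_num
    rw [this, add_smul, one_smul]
    simp
  have hcol : ∀ c, H *ᵥ Pi.single c 1 = Pi.single c 1 - (2 / q * w c) • w := fun c => by
    ext p
    simp only [H, sub_mulVec, one_mulVec, smul_mulVec, vecMulVec_mulVec]
    simp; ring
  have hentry : ∀ i c, conjTuple H X i c c =
      X i c c - (4 / q) * (w c * (X i *ᵥ w) c) + (4 / q ^ 2) * (w c ^ 2 * (w ⬝ᵥ X i *ᵥ w)) := by
    intro i c
    have h1 : conjTuple H X i c c =
        (H *ᵥ Pi.single c 1) ⬝ᵥ X i *ᵥ (H *ᵥ Pi.single c 1) := by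
      have : (H *ᵥ Pi.single c 1) ⬝ᵥ X i *ᵥ (H *ᵥ Pi.single c 1) =
          Pi.single c 1 ⬝ᵥ Hᵀ *ᵥ (X i *ᵥ (H *ᵥ Pi.single c 1)) := by
        rw [dotProduct_mulVec _ Hᵀ, vecMul_transpose]
      rw [this, mulVec_mulVec, mulVec_mulVec, single_one_dotProduct, mulVec_single_one]
      rfl
    have h2 : w ⬝ᵥ X i *ᵥ Pi.single c 1 = (X i *ᵥ w) c := by
      rw [dotProduct_mulVec, ← mulVec_transpose, hsymm, dotProduct_single_one]
    rw [h1, hcol, mulVec_sub, mulVec_smul, sub_dotProduct, dotProduct_sub, dotProduct_sub,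
      smul_dotProduct, smul_dotProduct, dotProduct_smul, dotProduct_smul, h2,
      single_one_dotProduct, single_one_dotProduct]
    simp
    field_simp
    ring
  have := hmax H hH
  simp only [hentry, Finset.sum_add_distrib, Finset.sum_sub_distrib, ← Finset.mul_sum] at this
  have h3 : (4 / q ^ 2) * ∑ i, w (τ i) ^ 2 * (w ⬝ᵥ X i *ᵥ w) ≤
      (4 / q) * ∑ i, w (τ i) * (X i *ᵥ w) (τ i) := by linarith
  have h4 := mul_le_mul_of_nonneg_left h3 (by positivity : 0 ≤ q ^ 2 / 4)
  have h5 : q ^ 2 / 4 * (4 / q ^ 2) = 1 := by field_simp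
  have h6 : q ^ 2 / 4 * (4 / q) = q := by field_simp
  rwa [← mul_assoc, ← mul_assoc, h5, h6, one_mul] at h4

theorem entry_eq_zero_of_maximal {d k : ℕ} {X : Fin k → Matrix (Fin d) (Fin d) ℝ}
    (hsymm : ∀ i, (X i)ᵀ = X i) {τ : Fin k → Fin d} (hτ : Function.Injective τ)
    (hmax : ∀ U : Matrix (Fin d) (Fin d) ℝ, Uᵀ * U = 1 →
      ∑ i, conjTuple U X i (τ i) (τ i) ≤ ∑ i, X i (τ i) (τ i))
    (i : Fin k) {b : Fin d} (hb : b ∉ Set.range τ) : X i (τ i) b = 0 := by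
  have hbi : ∀ l, b ≠ τ l := fun l h => hb ⟨l, h.symm⟩
  have hs : X i b (τ i) = X i (τ i) b := congr_fun (congr_fun (hsymm i) (τ i)) b
  refine linear_coeff_eq_zero_of_nonneg (K := X i (τ i) (τ i) - X i b b)
    (L := - X i (τ i) b) (N := 0) fun t => ?_
  have h := reflection_inequality hsymm τ hmax (Pi.single b 1 + t • Pi.single (τ i) 1)
  rw [Finset.sum_eq_single i, Finset.sum_eq_single i] at h
  · simp [mulVec_add, mulVec_smul, hbi i, (hbi i).symm, hs] at h
    linarith [h]
  · intro l _ hl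
    simp [(hbi l).symm, hτ.ne hl]
  · simp
  · intro l _ hl
    simp [(hbi l).symm, hτ.ne hl]
  · simp

theorem entry_eq_of_maximal {d k : ℕ} {X : Fin k → Matrix (Fin d) (Fin d) ℝ}
    (hsymm : ∀ i, (X i)ᵀ = X i) {τ : Fin k → Fin d} (hτ : Function.Injective τ)
    (hmax : ∀ U : Matrix (Fin d) (Fin d) ℝ, Uᵀ * U = 1 →
      ∑ i, conjTuple U X i (τ i) (τ i) ≤ ∑ i, X i (τ i) (τ i))
    {i j : Fin k} (hij : i ≠ j) : X i (τ i) (τ j) = X j (τ i) (τ j) := by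
  have hne : τ i ≠ τ j := hτ.ne hij
  have hs : ∀ l, X l (τ j) (τ i) = X l (τ i) (τ j) :=
    fun l => congr_fun (congr_fun (hsymm l) (τ i)) (τ j)
  rw [← sub_eq_zero]
  refine linear_coeff_eq_zero_of_nonneg
    (K := X i (τ i) (τ i) + X j (τ j) (τ j) - X i (τ j) (τ j) - X j (τ i) (τ i))
    (L := X j (τ i) (τ j) - X i (τ i) (τ j)) (N := 0) fun t => ?_
  have h := reflection_inequality hsymm τ hmax (Pi.single (τ j) 1 + t • Pi.single (τ i) 1)
  rw [Fintype.sum_eq_add i j hij, Fintype.sum_eq_add i j hij] at h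
  · simp [mulVec_add, mulVec_smul, hne, hne.symm, hs] at h
    linarith [h]
  · intro l hl
    simp [hτ.ne hl.1, hτ.ne hl.2]
  · intro l hl
    simp [hτ.ne hl.1, hτ.ne hl.2]

/-- At a tuple of maximal selected diagonal mass, every entry deviates from the coordinate
projections by at most the missing diagonal mass. -/
theorem abs_sub_coordProj_le {d k : ℕ} {X : Fin k → Matrix (Fin d) (Fin d) ℝ}
    (hX : PrimalFeasible X) {τ : Fin k → Fin d} (hτ : Function.Injective τ)
    (hmax : ∀ U : Matrix (Fin d) (Fin d) ℝ, Uᵀ * U = 1 →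
      ∑ i, conjTuple U X i (τ i) (τ i) ≤ ∑ i, X i (τ i) (τ i))
    (i : Fin k) (a b : Fin d) :
    |(X - coordProj τ) i a b| ≤ ∑ l, (1 - X l (τ l) (τ l)) := by
  have hsymm : ∀ i, (X i)ᵀ = X i := fun i => by simpa using (hX.1 i).1.eq
  have hdiag : ∀ l c, 0 ≤ X l c c := fun l c => (hX.1 l).diag_nonneg
  have htr : ∀ l, ∑ c, X l c c = 1 := fun l => hX.2.1 l
  have hle1 : ∀ l c, X l c c ≤ 1 := fun l c =>
    (le_abs_self _).trans (abs_entry_le_one_of_feasible hX l c c)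
  have hrest : ∀ l c, c ≠ τ l → X l c c ≤ 1 - X l (τ l) (τ l) := by
    intro l c hc
    rw [le_sub_iff_add_le, ← htr l]
    exact Finset.add_le_sum (f := fun c => X l c c) (fun c _ => hdiag l c)
      (Finset.mem_univ _) (Finset.mem_univ _) hc
  have hmiss : ∀ l, 0 ≤ 1 - X l (τ l) (τ l) := fun l => by linarith [hle1 l (τ l)]
  have hmissle : ∀ l, 1 - X l (τ l) (τ l) ≤ ∑ l, (1 - X l (τ l) (τ l)) := fun l =>
    Finset.single_le_sum (f := fun l => 1 - X l (τ l) (τ l)) (fun l _ => hmiss l)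
      (Finset.mem_univ l)
  have hoff : ∀ l a b, a ≠ τ l → b ≠ τ l → |X l a b| ≤ 1 - X l (τ l) (τ l) := by
    intro l a b ha hb
    linarith [abs_entry_le_of_posSemidef (hX.1 l) a b, hrest l a ha, hrest l b hb]
  have hslack : ∀ i, (1 - ∑ l, X l) (τ i) (τ i) ≤ 1 - X i (τ i) (τ i) := by
    intro i
    rw [Matrix.sub_apply, Matrix.sum_apply, one_apply_eq]
    have := Finset.single_le_sum (f := fun l => X l (τ i) (τ i)) (fun l _ => hdiag l (τ i))
      (Finset.mem_univ i)
    linarith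
  have hrow : ∀ b, b ≠ τ i → |X i (τ i) b| ≤ ∑ l, (1 - X l (τ l) (τ l)) := by
    intro b hb
    by_cases hbr : b ∈ Set.range τ
    · obtain ⟨j, rfl⟩ := hbr
      have hij : i ≠ j := fun h => hb (h ▸ rfl)
      have heq := entry_eq_of_maximal hsymm hτ hmax hij
      have hS := abs_entry_le_of_posSemidef hX.2.2 (τ i) (τ j)
      rw [Matrix.sub_apply, Matrix.sum_apply, one_apply_ne (hτ.ne hij), zero_sub, abs_neg] at hS
      have hsplit : ∀ f : Fin k → ℝ, ∑ l, f l =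
          f i + f j + ∑ l ∈ (Finset.univ.erase i).erase j, f l := fun f => by
        rw [← Finset.add_sum_erase _ f (Finset.mem_univ i), ← Finset.add_sum_erase _ f
          (Finset.mem_erase.2 ⟨hij.symm, Finset.mem_univ j⟩), add_assoc]
      have hother : |∑ l ∈ (Finset.univ.erase i).erase j, X l (τ i) (τ j)| ≤
          ∑ l ∈ (Finset.univ.erase i).erase j, (1 - X l (τ l) (τ l)) := by
        refine (Finset.abs_sum_le_sum_abs _ _).trans (Finset.sum_le_sum fun l hl => ?_)
        simp only [Finset.mem_erase, Finset.mem_univ, and_true] at hl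
        exact hoff l _ _ (hτ.ne hl.2.symm) (hτ.ne hl.1.symm)
      rw [hsplit] at hS
      rw [hsplit]
      have h1 := hslack i
      have h2 := hslack j
      have h3 := hmiss i
      have h4 := hmiss j
      rw [← heq] at hS
      rw [abs_le] at hS hother ⊢
      constructor <;> linarith
    · rw [entry_eq_zero_of_maximal hsymm hτ hmax i hbr, abs_zero]
      exact Finset.sum_nonneg fun l _ => hmiss l
  have hsub : (X - coordProj τ) i a b = X i a b - coordProj τ i a b := rfl
  rw [hsub]
  by_cases ha : a = τ i
  · subst ha
    by_cases hb : b = τ i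
    · subst hb
      rw [abs_sub_comm, abs_of_nonneg]
      · simpa [coordProj] using hmissle i
      · simpa [coordProj] using hle1 i (τ i)
    · simpa [coordProj, diagonal_apply_ne' _ hb] using hrow b hb
  · have hz : coordProj τ i a b = 0 := by
      by_cases hab : a = b
      · subst hab; simp [coordProj, ha]
      · simp [coordProj, diagonal_apply_ne _ hab]
    rw [hz, sub_zero]
    by_cases hb : b = τ i
    · subst hb
      have : X i a (τ i) = X i (τ i) a := congr_fun (congr_fun (hsymm i) (τ i)) a
      rw [this]
      exact hrow a ha
    · exact (hoff i a b ha hb).trans (hmissle i)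

theorem sum_sq_col_eq_one {d : ℕ} {U : Matrix (Fin d) (Fin d) ℝ} (hU : Uᵀ * U = 1) (b : Fin d) :
    ∑ a, U a b ^ 2 = 1 := by
  have := congr_fun (congr_fun hU b) b
  rw [mul_apply, one_apply_eq] at this
  simpa [sq] using this

theorem isCompact_transpose_mul_self_eq_one (d : ℕ) :
    IsCompact {U : Matrix (Fin d) (Fin d) ℝ | Uᵀ * U = 1} := by
  have hbox : IsCompact {U : Fin d → Fin d → ℝ | ∀ a b, U a b ∈ Set.Icc (-1) 1} := by
    have : IsCompact (Set.univ.pi fun _ : Fin d => Set.univ.pi fun _ : Fin d =>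
        Set.Icc (-1 : ℝ) 1) :=
      isCompact_univ_pi fun _ => isCompact_univ_pi fun _ => isCompact_Icc
    convert this using 1
    ext U
    simp only [Set.mem_ofPred_eq, Set.mem_univ_pi]
  refine IsCompact.of_isClosed_subset
    (s := {U : Matrix (Fin d) (Fin d) ℝ | ∀ a b, U a b ∈ Set.Icc (-1) 1}) hbox
    (isClosed_eq (by fun_prop) continuous_const) fun U hU a b => ?_
  rw [Set.mem_Icc, ← abs_le, ← sq_le_one_iff_abs_le_one, ← sum_sq_col_eq_one hU b]
  exact Finset.single_le_sum (f := fun a => U a b ^ 2) (fun a _ => sq_nonneg _)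
    (Finset.mem_univ a)

/-- An orthogonal matrix whose `j`-th diagonal entry squares to one has vanishing off-diagonal
entries in its `j`-th column. -/
theorem entry_eq_zero_of_sq_diag_eq_one {d : ℕ} {U : Matrix (Fin d) (Fin d) ℝ} (hU : Uᵀ * U = 1)
    {j : Fin d} (hj : U j j ^ 2 = 1) {a : Fin d} (ha : a ≠ j) : U a j = 0 := by
  have h := sum_sq_col_eq_one hU j
  have := Finset.add_le_sum (f := fun a => U a j ^ 2) (fun a _ => sq_nonneg _)
      (Finset.mem_univ a) (Finset.mem_univ j) ha
  simp only [h, hj] at this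
  nlinarith [sq_nonneg (U a j)]

theorem conjTuple_apply_of_sq_diag_eq_one {d k : ℕ} {U : Matrix (Fin d) (Fin d) ℝ}
    (hU : Uᵀ * U = 1) {j : Fin d} (hj : U j j ^ 2 = 1) (X : Fin k → Matrix (Fin d) (Fin d) ℝ)
    (i : Fin k) : conjTuple U X i j j = X i j j := by
  rw [conjTuple, mul_apply, Finset.sum_eq_single j, mul_apply, Finset.sum_eq_single j,
    transpose_apply]
  · linear_combination X i j j * hj
  · intro a _ ha
    rw [transpose_apply, entry_eq_zero_of_sq_diag_eq_one hU hj ha, zero_mul]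
  · simp
  · intro a _ ha
    rw [entry_eq_zero_of_sq_diag_eq_one hU hj ha, mul_zero]
  · simp

theorem tendsto_conjTuple {d k : ℕ} {U : ℕ → Matrix (Fin d) (Fin d) ℝ}
    {X : ℕ → Fin k → Matrix (Fin d) (Fin d) ℝ} {V : Matrix (Fin d) (Fin d) ℝ}
    {Y : Fin k → Matrix (Fin d) (Fin d) ℝ} (hU : Filter.Tendsto U Filter.atTop (nhds V))
    (hX : Filter.Tendsto X Filter.atTop (nhds Y)) :
    Filter.Tendsto (fun n => conjTuple (U n) (X n)) Filter.atTop (nhds (conjTuple V Y)) := by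
  have hcont : Continuous
      (Function.uncurry (conjTuple : Matrix (Fin d) (Fin d) ℝ → _ → Fin k → _)) :=
    continuous_pi fun i => by
      simp only [Function.uncurry_def, conjTuple]
      fun_prop
  have h := (hcont.tendsto (V, Y)).comp (hU.prodMk_nhds hX)
  simpa only [Function.comp_def, Function.uncurry_apply_pair] using h

/-- If conjugating back a sequence converging to the coordinate projections recovers the full
selected diagonal entry in the limit, then the limiting orthogonal matrix fixes the selected
coordinate axis. -/
theorem sq_diag_eq_one_of_tendsto {d k : ℕ} {U : ℕ → Matrix (Fin d) (Fin d) ℝ}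
    {X : ℕ → Fin k → Matrix (Fin d) (Fin d) ℝ} {V : Matrix (Fin d) (Fin d) ℝ}
    {τ : Fin k → Fin d} (hU : Filter.Tendsto U Filter.atTop (nhds V))
    (hX : Filter.Tendsto X Filter.atTop (nhds (coordProj τ))) (i : Fin k)
    (hdiag : Filter.Tendsto (fun n => conjTuple (U n)ᵀ (X n) i (τ i) (τ i)) Filter.atTop
      (nhds 1)) : V (τ i) (τ i) ^ 2 = 1 := by
  have hUt : Filter.Tendsto (fun n => (U n)ᵀ) Filter.atTop (nhds Vᵀ) :=
    ((by fun_prop : Continuous fun A : Matrix (Fin d) (Fin d) ℝ => Aᵀ).tendsto V).comp hU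
  have hentry : Continuous fun Y : Fin k → Matrix (Fin d) (Fin d) ℝ => Y i (τ i) (τ i) :=
    (continuous_apply i).matrix_elem _ _
  have hlim : Filter.Tendsto (fun n => conjTuple (U n)ᵀ (X n) i (τ i) (τ i)) Filter.atTop
      (nhds (conjTuple Vᵀ (coordProj τ) i (τ i) (τ i))) :=
    (hentry.tendsto _).comp (tendsto_conjTuple hUt hX)
  rw [tendsto_nhds_unique hdiag hlim]
  simp [conjTuple, coordProj, sq, mul_apply, diagonal_apply, Pi.single_apply]

theorem tendsto_sum_abs_sub {d k : ℕ} {M : ℕ → Fin k → Matrix (Fin d) (Fin d) ℝ}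
    {D : Fin k → Matrix (Fin d) (Fin d) ℝ} (hM : Filter.Tendsto M Filter.atTop (nhds D)) :
    Filter.Tendsto (fun n => ∑ i, ∑ a, ∑ b, |(M n - D) i a b|) Filter.atTop (nhds 0) := by
  have habs : Continuous fun N : Fin k → Matrix (Fin d) (Fin d) ℝ =>
      ∑ i, ∑ a, ∑ b, |(N - D) i a b| := by
    simp only [Pi.sub_apply, Matrix.sub_apply]
    fun_prop
  have h := (habs.tendsto D).comp hM
  simp only [sub_self, Pi.zero_apply, Matrix.zero_apply, abs_zero, Finset.sum_const_zero] at h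
  exact h

theorem conjTuple_conjTuple {d k : ℕ} (U W : Matrix (Fin d) (Fin d) ℝ)
    (X : Fin k → Matrix (Fin d) (Fin d) ℝ) :
    conjTuple W (conjTuple U X) = conjTuple (U * W) X := by
  funext i
  simp only [conjTuple, transpose_mul, Matrix.mul_assoc]

/-- Along a sequence of instances converging to one with a sharp coordinate solution, optimal
solutions eventually have rank one. -/
theorem exists_rank_eq_one_of_tendsto {d k : ℕ} {D : Fin k → Matrix (Fin d) (Fin d) ℝ}
    {τ : Fin k → Fin d} (hτ : Function.Injective τ) {c : ℝ} (hc : 0 < c)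
    (hsharp : ∀ Y, PrimalFeasible Y →
      primalObj D Y ≤ primalObj D (coordProj τ) - c * ∑ i, (1 - Y i (τ i) (τ i)))
    {M X : ℕ → Fin k → Matrix (Fin d) (Fin d) ℝ}
    (hM : Filter.Tendsto M Filter.atTop (nhds D)) (hX : ∀ n, PrimalOptimal (M n) (X n)) :
    ∃ n, ∀ i, (X n i).rank = 1 := by
  have hEfeas := coordProj_feasible hτ
  have hexU : ∀ n, ∃ U : Matrix (Fin d) (Fin d) ℝ, Uᵀ * U = 1 ∧
      ∀ W : Matrix (Fin d) (Fin d) ℝ, Wᵀ * W = 1 →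
        ∑ i, conjTuple W (X n) i (τ i) (τ i) ≤ ∑ i, conjTuple U (X n) i (τ i) (τ i) := by
    intro n
    obtain ⟨U, hU, hmax⟩ := (isCompact_transpose_mul_self_eq_one d).exists_isMaxOn
      ⟨1, by simp⟩ (f := fun U => ∑ i, conjTuple U (X n) i (τ i) (τ i)) (by
        simp only [conjTuple]
        exact (continuous_finsetSum _ fun i _ => (by fun_prop : Continuous
          fun U : Matrix (Fin d) (Fin d) ℝ => Uᵀ * X n i * U).matrix_elem _ _).continuousOn)
    exact ⟨U, hU, fun W hW => hmax hW⟩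
  choose U hU hUmax using hexU
  have : FirstCountableTopology (Matrix (Fin d) (Fin d) ℝ) :=
    inferInstanceAs (FirstCountableTopology (Fin d → Fin d → ℝ))
  obtain ⟨V, hV, φ, hφ, hUV⟩ := (isCompact_transpose_mul_self_eq_one d).tendsto_subseq hU
  have hV : Vᵀ * V = 1 := hV
  set X' := fun n => conjTuple (U n) (X n) with hX'
  set δ := fun n => ∑ i, (1 - X' n i (τ i) (τ i)) with hδ
  set η := fun n => ∑ i, (1 - X n i (τ i) (τ i)) with hη
  have hX'opt : ∀ n, PrimalOptimal (conjTuple (U n) (M n)) (X' n) :=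
    fun n => (hX n).conjTuple (hU n)
  have hdev : ∀ n i a b, |(X' n - coordProj τ) i a b| ≤ δ n := fun n =>
    abs_sub_coordProj_le (hX'opt n).1 hτ fun W hW => by
      rw [hX', conjTuple_conjTuple]
      refine hUmax n _ ?_
      rw [transpose_mul, Matrix.mul_assoc, ← Matrix.mul_assoc _ (U n) W, hU, Matrix.one_mul, hW]
  have hmiss : ∀ {Y : Fin k → Matrix (Fin d) (Fin d) ℝ}, PrimalFeasible Y →
      ∀ i, 0 ≤ 1 - Y i (τ i) (τ i) := fun hY i =>
    sub_nonneg.2 ((le_abs_self _).trans (abs_entry_le_one_of_feasible hY i _ _))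
  have hδ0 : ∀ n, 0 ≤ δ n := fun n => Finset.sum_nonneg fun i _ => hmiss (hX'opt n).1 i
  have hδη : ∀ n, δ n ≤ η n := by
    intro n
    have := hUmax n 1 (by simp)
    simp only [hδ, hη, Finset.sum_sub_distrib]
    simp only [conjTuple, transpose_one, Matrix.one_mul, Matrix.mul_one] at this
    simp only [hX', conjTuple]
    linarith
  have herr : ∀ n, c * η n ≤ (∑ i, ∑ a, ∑ b, |(M n - D) i a b|) * 2 := by
    intro n
    have h1 := hsharp _ (hX n).1
    have h2 := (hX n).2 _ hEfeas
    have h3 := primalObj_le_of_entry_le (M n - D) (X n - coordProj τ) 2 fun i a b => by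
      refine (abs_sub _ _).trans ?_
      linarith [abs_entry_le_one_of_feasible (hX n).1 i a b,
        abs_entry_le_one_of_feasible hEfeas i a b]
    rw [primalObj_sub_left, primalObj_sub_right, primalObj_sub_right] at h3
    simp only [hη]
    linarith
  have hηlim : Filter.Tendsto η Filter.atTop (nhds 0) := by
    have hlim : Filter.Tendsto (fun n => (∑ i, ∑ a, ∑ b, |(M n - D) i a b|) * 2 / c)
        Filter.atTop (nhds 0) := by
      have := ((tendsto_sum_abs_sub hM).mul_const 2).div_const c
      simpa using this
    refine squeeze_zero (fun n => (hδ0 n).trans (hδη n)) (fun n => ?_) hlim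
    rw [le_div_iff₀ hc, mul_comm]
    exact herr n
  have hδlim : Filter.Tendsto δ Filter.atTop (nhds 0) := squeeze_zero hδ0 hδη hηlim
  have hX'lim : Filter.Tendsto X' Filter.atTop (nhds (coordProj τ)) := by
    refine tendsto_pi_nhds.2 fun i => tendsto_pi_nhds.2 fun a => tendsto_pi_nhds.2 fun b => ?_
    rw [tendsto_iff_dist_tendsto_zero]
    exact squeeze_zero (fun n => dist_nonneg) (fun n => hdev n i a b) hδlim
  have hVdiag : ∀ i, V (τ i) (τ i) ^ 2 = 1 := by
    intro i
    have h1 : Filter.Tendsto (fun n => 1 - X n i (τ i) (τ i)) Filter.atTop (nhds 0) :=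
      squeeze_zero (fun n => hmiss (hX n).1 i) (fun n => Finset.single_le_sum
        (f := fun i => 1 - X n i (τ i) (τ i)) (fun i _ => hmiss (hX n).1 i)
        (Finset.mem_univ i)) hηlim
    have h2 : ∀ n, conjTuple (U n)ᵀ (X' n) = X n := fun n => by
      have := conjTuple_conjTuple_transpose (U := (U n)ᵀ) (mul_eq_one_comm.1 (hU n)) (X n)
      rwa [transpose_transpose] at this
    have h3 : Filter.Tendsto (fun n => X n i (τ i) (τ i)) Filter.atTop (nhds 1) := by
      simpa using h1.const_sub 1
    refine sq_diag_eq_one_of_tendsto hUV (hX'lim.comp hφ.tendsto_atTop) i ?_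
    simp only [Function.comp_apply, h2]
    exact h3.comp hφ.tendsto_atTop
  have hVt : Vᵀᵀ * Vᵀ = 1 := mul_eq_one_comm.1 hV
  have hVtdiag : ∀ i, Vᵀ (τ i) (τ i) ^ 2 = 1 := hVdiag
  have hsharpV : ∀ Y, PrimalFeasible Y → primalObj (conjTuple V D) (Y - coordProj τ) ≤
      - (c * ∑ i, (1 - Y i (τ i) (τ i))) := by
    intro Y hY
    have h1 := hsharp _ (hY.conjTuple hVt)
    simp only [conjTuple_apply_of_sq_diag_eq_one hVt (hVtdiag _)] at h1
    rw [← primalObj_conjTuple hV, conjTuple_conjTuple_transpose hV] at h1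
    rw [primalObj_sub_right, primalObj_coordProj]
    simp only [conjTuple_apply_of_sq_diag_eq_one hV (hVdiag _)]
    rw [primalObj_coordProj] at h1
    linarith
  have hM'lim : Filter.Tendsto
      (fun n => ∑ i, ∑ a, ∑ b, |(conjTuple (U (φ n)) (M (φ n)) - conjTuple V D) i a b|)
      Filter.atTop (nhds 0) :=
    tendsto_sum_abs_sub (tendsto_conjTuple hUV (hM.comp hφ.tendsto_atTop))
  obtain ⟨n, hn⟩ := (hM'lim.eventually_lt_const hc).exists
  refine ⟨φ n, ?_⟩
  generalize φ n = m at hn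
  have h1 := hsharpV _ (hX'opt m).1
  have h2 := (hX'opt m).2 _ hEfeas
  have h3 := primalObj_le_of_entry_le (conjTuple (U m) (M m) - conjTuple V D)
    (X' m - coordProj τ) (δ m) (hdev m)
  rw [primalObj_sub_left, primalObj_sub_right] at h3
  have hδm : δ m = 0 := by
    by_contra hne
    have hpos : 0 < δ m := lt_of_le_of_ne (hδ0 m) (Ne.symm hne)
    have : c * δ m ≤ (∑ i, ∑ a, ∑ b, |(conjTuple (U m) (M m) - conjTuple V D) i a b|) * δ m := by
      simp only [hδ] at h3 ⊢
      linarith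
    exact absurd (le_of_mul_le_mul_right this hpos) (not_le.2 hn)
  intro i
  have hXi : (U m)ᵀ * X m i * U m = coordProj τ i := by
    ext a b
    have := hdev m i a b
    rw [hδm] at this
    exact sub_eq_zero.1 (abs_nonpos_iff.1 this)
  have hdet : IsUnit (U m).det := isUnit_det_of_left_inverse (hU m)
  have hrank : ((U m)ᵀ * X m i * U m).rank = (X m i).rank := by
    rw [rank_mul_eq_left_of_isUnit_det _ _ hdet,
      rank_mul_eq_right_of_isUnit_det _ _ (by rwa [det_transpose])]
  rw [← hrank, hXi, coordProj, rank_diagonal]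
  simp [Pi.single_apply]

theorem abs_entry_le_specNorm {d : ℕ} (A : Matrix (Fin d) (Fin d) ℝ) (a b : Fin d) :
    |A a b| ≤ specNorm A := by
  have h1 := (toEuclideanCLM (𝕜 := ℝ) A).le_opNorm (EuclideanSpace.single b 1)
  have h2 := PiLp.norm_apply_le (toEuclideanCLM (𝕜 := ℝ) A (EuclideanSpace.single b 1)) a
  have h3 : toEuclideanCLM (𝕜 := ℝ) A (EuclideanSpace.single b 1) a = A a b := by
    rw [ofLp_toEuclideanCLM]
    simp
  rw [h3, Real.norm_eq_abs] at h2
  simpa [specNorm] using h2.trans h1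

/-- **Tightness of (SDP-P) near jointly diagonalizable instances** (Theorem 4.3): if the data
`M̄ i` satisfy `0 ⪯ M̄ i ⪯ μI`, are jointly diagonalizable, and (SDP-P) with data `M̄` has a
unique optimal solution, then every admissible instance `M` in a spectral-norm neighborhood
of `M̄` has all its primal optimal solutions of rank one. -/
theorem rank_one_near_jointly_diagonalizable {d k : ℕ} (hk : 1 ≤ k) (hkd : k ≤ d)
    (μ : ℝ) (hμ : 0 < μ)
    (Mbar : Fin k → Matrix (Fin d) (Fin d) ℝ)
    (hMbarPSD : ∀ i, (Mbar i).PosSemidef)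
    (hMbarLe : ∀ i, (μ • (1 : Matrix (Fin d) (Fin d) ℝ) - Mbar i).PosSemidef)
    (hdiag : ∃ Q : Matrix (Fin d) (Fin d) ℝ, Qᵀ * Q = 1 ∧ ∀ i, (Qᵀ * Mbar i * Q).IsDiag)
    (huniq : ∃! X : Fin k → Matrix (Fin d) (Fin d) ℝ,
      PrimalFeasible X ∧ ∀ X', PrimalFeasible X' → primalObj Mbar X' ≤ primalObj Mbar X) :
    ∃ ε > (0 : ℝ), ∀ M : Fin k → Matrix (Fin d) (Fin d) ℝ,
      (∀ i, (M i).PosSemidef) →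
      (∀ i, (μ • (1 : Matrix (Fin d) (Fin d) ℝ) - M i).PosSemidef) →
      (∀ i, specNorm (M i - Mbar i) < ε) →
      ∀ X : Fin k → Matrix (Fin d) (Fin d) ℝ,
        PrimalFeasible X → (∀ X', PrimalFeasible X' → primalObj M X' ≤ primalObj M X) →
        ∀ i, (X i).rank = 1 := by
  obtain ⟨Q, hQ, hdiag⟩ := hdiag
  have hQt : Qᵀᵀ * Qᵀ = 1 := mul_eq_one_comm.1 hQ
  have hback : ∀ X : Fin k → Matrix (Fin d) (Fin d) ℝ, conjTuple Qᵀ (conjTuple Q X) = X :=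
    fun X => by simpa using conjTuple_conjTuple_transpose hQt X
  obtain ⟨τ, hτ, c, hc, hsharp⟩ := exists_sharp_of_isDiag hkd (conjTuple Q Mbar) hdiag
    fun X Y hX hY => by
      have hX' := hX.conjTuple hQt
      have hY' := hY.conjTuple hQt
      rw [hback] at hX' hY'
      rw [← conjTuple_conjTuple_transpose hQ X, huniq.unique hX' hY',
        conjTuple_conjTuple_transpose hQ]
  by_contra! hcon
  choose M _ _ hMnear X hXfeas hXmax i hi using fun n : ℕ =>
    hcon (1 / ((n : ℝ) + 1)) Nat.one_div_pos_of_nat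
  have hMlim : Filter.Tendsto M Filter.atTop (nhds Mbar) := by
    refine tendsto_pi_nhds.2 fun j => tendsto_pi_nhds.2 fun a => tendsto_pi_nhds.2 fun b => ?_
    rw [tendsto_iff_dist_tendsto_zero]
    exact squeeze_zero (fun n => dist_nonneg)
      (fun n => (abs_entry_le_specNorm (M n j - Mbar j) a b).trans (hMnear n j).le)
      tendsto_one_div_add_atTop_nhds_zero_nat
  obtain ⟨n, hn⟩ := exists_rank_eq_one_of_tendsto hτ hc hsharp
    (tendsto_conjTuple tendsto_const_nhds hMlim)
    fun n => PrimalOptimal.conjTuple hQ ⟨hXfeas n, hXmax n⟩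
  have hdet : IsUnit Q.det := isUnit_det_of_left_inverse hQ
  refine hi n ?_
  rw [← hn (i n), conjTuple, rank_mul_eq_left_of_isUnit_det _ _ hdet,
    rank_mul_eq_right_of_isUnit_det _ _ (by rwa [det_transpose])]
end

section
/- Under Assumptions 1 and 2, let (c^k) be a sequence in C converging to c̄ ∈ C. Then the sequence of sets (Feas(D;c^k) ∩ Extra(D)) converges to Feas(D;c̄) ∩ Extra(D), in the sense of the stated notion of convergence of bounded sets. -/
open Matrix Filter

/-- The dual feasible set `Feas(D;c) = {y : c − Aᵀy ∈ K*}`. -/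
def FeasD {m n : ℕ} (A : Matrix (Fin m) (Fin n) ℝ) (Kstar : Set (Fin n → ℝ))
    (c : Fin n → ℝ) : Set (Fin m → ℝ) :=
  {y | c - Aᵀ *ᵥ y ∈ Kstar}

/-- The extra polyhedral set `Extra(D) = {y : f − Eᵀy ≥ 0}`. -/
def ExtraD {m q : ℕ} (E : Matrix (Fin m) (Fin q) ℝ) (f : Fin q → ℝ) : Set (Fin m → ℝ) :=
  {y | ∀ j, 0 ≤ f j - (Eᵀ *ᵥ y) j}

/-- Convergence of a sequence of bounded sets `L k` to a bounded set `Lbar`: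
(i) every limit (cluster) point of a selection `y k ∈ L k` lies in `Lbar`, and
(ii) every point of `Lbar` is a limit (cluster) point of some selection `y k ∈ L k`. -/
def SetConv {m : ℕ} (L : ℕ → Set (Fin m → ℝ)) (Lbar : Set (Fin m → ℝ)) : Prop :=
  (∀ y : ℕ → (Fin m → ℝ), (∀ k, y k ∈ L k) →
    ∀ p, MapClusterPt p atTop y → p ∈ Lbar) ∧
  (∀ ybar ∈ Lbar, ∃ y : ℕ → (Fin m → ℝ), (∀ k, y k ∈ L k) ∧ MapClusterPt ybar atTop y)

theorem isClosed_dualCone {n : ℕ} (K : Set (Fin n → ℝ)) :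
    IsClosed {s : Fin n → ℝ | ∀ x ∈ K, 0 ≤ s ⬝ᵥ x} := by
  simp only [Set.ofPred_forall]
  exact isClosed_biInter fun x _ => isClosed_le continuous_const (by fun_prop)

theorem convex_dualCone {n : ℕ} (K : Set (Fin n → ℝ)) :
    Convex ℝ {s : Fin n → ℝ | ∀ x ∈ K, 0 ≤ s ⬝ᵥ x} := by
  intro s hs t ht a b ha hb _ x hx
  rw [add_dotProduct, smul_dotProduct, smul_dotProduct]
  exact add_nonneg (mul_nonneg ha (hs x hx)) (mul_nonneg hb (ht x hx))

/-- The graph of the truncated feasible set map is closed. -/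
theorem isClosed_graph_feasD_inter_extraD {m n q : ℕ} (A : Matrix (Fin m) (Fin n) ℝ)
    (E : Matrix (Fin m) (Fin q) ℝ) (f : Fin q → ℝ) {S : Set (Fin n → ℝ)} (hS : IsClosed S) :
    IsClosed {p : (Fin n → ℝ) × (Fin m → ℝ) | p.2 ∈ FeasD A S p.1 ∩ ExtraD E f} := by
  refine IsClosed.inter (hS.preimage (f := fun p : (Fin n → ℝ) × (Fin m → ℝ) =>
    p.1 - Aᵀ *ᵥ p.2) (by fun_prop)) ?_
  change IsClosed {p : (Fin n → ℝ) × (Fin m → ℝ) | ∀ j, 0 ≤ f j - (Eᵀ *ᵥ p.2) j}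
  simp only [Set.ofPred_forall]
  exact isClosed_iInter fun j => isClosed_le continuous_const (by fun_prop)

/-- A strictly feasible point stays feasible under small perturbations of the parameter. -/
theorem eventually_mem_feasD_inter_extraD {m n q : ℕ} (A : Matrix (Fin m) (Fin n) ℝ)
    (E : Matrix (Fin m) (Fin q) ℝ) (f : Fin q → ℝ) {S : Set (Fin n → ℝ)}
    {c : ℕ → (Fin n → ℝ)} {cbar : Fin n → ℝ} (hc : Tendsto c atTop (nhds cbar))
    {y : Fin m → ℝ} (hy : cbar - Aᵀ *ᵥ y ∈ interior S) (hE : y ∈ ExtraD E f) :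
    ∀ᶠ k in atTop, y ∈ FeasD A S (c k) ∩ ExtraD E f := by
  filter_upwards [(hc.sub_const (Aᵀ *ᵥ y)).eventually (isOpen_interior.mem_nhds hy)] with k hk
  have hmem : c k - Aᵀ *ᵥ y ∈ S := interior_subset hk
  exact ⟨hmem, hE⟩

theorem convex_extraD {m q : ℕ} (E : Matrix (Fin m) (Fin q) ℝ) (f : Fin q → ℝ) :
    Convex ℝ (ExtraD E f) := by
  intro y hy z hz a b ha hb hab j
  have h := add_nonneg (mul_nonneg ha (hy j)) (mul_nonneg hb (hz j))
  simp only [mulVec_add, mulVec_smul, Pi.add_apply, Pi.smul_apply, smul_eq_mul]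
  linear_combination h + f j * hab

/-- Feasible points are limits of feasible points with interior slack, provided one exists. -/
theorem mem_closure_interior_feasD {m n q : ℕ} (A : Matrix (Fin m) (Fin n) ℝ)
    (E : Matrix (Fin m) (Fin q) ℝ) (f : Fin q → ℝ) {S : Set (Fin n → ℝ)} (hS : Convex ℝ S)
    {c : Fin n → ℝ} {y z : Fin m → ℝ} (hy : y ∈ FeasD A S c ∩ ExtraD E f)
    (hz : c - Aᵀ *ᵥ z ∈ interior S) (hzE : z ∈ ExtraD E f) :
    y ∈ closure {w | c - Aᵀ *ᵥ w ∈ interior S ∧ w ∈ ExtraD E f} := by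
  have hlim : Tendsto (fun t : ℝ => (1 - t) • y + t • z) (nhdsWithin 0 (Set.Ioi 0)) (nhds y) := by
    have hcont : Continuous fun t : ℝ => (1 - t) • y + t • z := by fun_prop
    simpa using (hcont.tendsto 0).mono_left nhdsWithin_le_nhds
  refine mem_closure_of_tendsto hlim ?_
  filter_upwards [Ioo_mem_nhdsGT (zero_lt_one' ℝ)] with t ht
  have ht' : 0 ≤ 1 - t := sub_nonneg.2 ht.2.le
  refine ⟨?_, convex_extraD E f hy.2 hzE ht' ht.1.le (by ring)⟩
  have h := hS.combo_self_interior_mem_interior hy.1 hz ht' ht.1 (by ring)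
  convert h using 1
  rw [mulVec_add, mulVec_smul, mulVec_smul]
  module

/-- **Continuity of the truncated dual feasible set** (Lemma D.1): under the interiority,
boundedness and optimality assumptions, if `c^k → c̄` in `C` then
`Feas(D;c^k) ∩ Extra(D) → Feas(D;c̄) ∩ Extra(D)` as a sequence of bounded sets. -/
theorem feasible_set_convergence {m n q : ℕ} (hm : 1 ≤ m) (hn : 1 ≤ n) (hq : 1 ≤ q)
    (A : Matrix (Fin m) (Fin n) ℝ) (b : Fin m → ℝ)
    (E : Matrix (Fin m) (Fin q) ℝ) (f : Fin q → ℝ)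
    (K : Set (Fin n → ℝ)) (hKclosed : IsClosed K) (hKconvex : Convex ℝ K)
    (hKcone : ∀ x ∈ K, ∀ t : ℝ, 0 ≤ t → t • x ∈ K)
    (C : Set (Fin n → ℝ)) (hCclosed : IsClosed C) (hCconvex : Convex ℝ C)
    (Kstar : Set (Fin n → ℝ)) (hKstar : Kstar = {s | ∀ x ∈ K, 0 ≤ s ⬝ᵥ x})
    -- Assumption 1
    (hA1primal : ∃ x ∈ interior K, A *ᵥ x = b)
    (hA1dual : ∀ c ∈ C, ∃ y : Fin m → ℝ, c - Aᵀ *ᵥ y ∈ interior Kstar)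
    -- Assumption 2
    (hA2bdd : ∀ c ∈ C, Bornology.IsBounded (FeasD A Kstar c ∩ ExtraD E f))
    (hA2int : ∀ c ∈ C, ∃ y ∈ FeasD A Kstar c ∩ ExtraD E f,
      c - Aᵀ *ᵥ y ∈ interior Kstar ∧ ∀ j, 0 < f j - (Eᵀ *ᵥ y) j)
    (hA2opt : ∀ c ∈ C, ∀ y ∈ FeasD A Kstar c,
      (∀ y' ∈ FeasD A Kstar c, b ⬝ᵥ y' ≤ b ⬝ᵥ y) → y ∈ ExtraD E f)
    -- the convergent sequence of parameters
    (cseq : ℕ → (Fin n → ℝ)) (hcseq : ∀ k, cseq k ∈ C)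
    (cbar : Fin n → ℝ) (hcbar : cbar ∈ C)
    (hconv : Tendsto cseq atTop (nhds cbar)) :
    SetConv (fun k => FeasD A Kstar (cseq k) ∩ ExtraD E f)
      (FeasD A Kstar cbar ∩ ExtraD E f) := by
  have hcl : IsClosed Kstar := hKstar ▸ isClosed_dualCone K
  have hcv : Convex ℝ Kstar := hKstar ▸ convex_dualCone K
  have hgraph := isClosed_graph_feasD_inter_extraD A E f hcl
  refine ⟨fun y hy p hp => ?_, fun ybar hybar => ?_⟩
  · obtain ⟨φ, hφ, hlim⟩ := hp.tendsto_subseq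
    exact hgraph.mem_of_tendsto ((hconv.comp hφ.tendsto_atTop).prodMk_nhds hlim)
      (Eventually.of_forall fun k => hy (φ k))
  · have hne : ∀ k, (FeasD A Kstar (cseq k) ∩ ExtraD E f).Nonempty := fun k =>
      let ⟨y, hy, _⟩ := hA2int _ (hcseq k)
      ⟨y, hy⟩
    have hclosed : ∀ k, IsClosed (FeasD A Kstar (cseq k) ∩ ExtraD E f) := fun k =>
      hgraph.preimage (Continuous.prodMk_right (cseq k))
    choose y hy hdist using fun k => (hclosed k).exists_infDist_eq_dist (hne k) ybar
    refine ⟨y, hy, Tendsto.mapClusterPt (Metric.tendsto_nhds.2 fun ε hε => ?_)⟩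
    obtain ⟨z, hz, hzint, -⟩ := hA2int _ hcbar
    obtain ⟨w, ⟨hwint, hwE⟩, hwdist⟩ := Metric.mem_closure_iff.1
      (mem_closure_interior_feasD A E f hcv hybar hzint hz.2) ε hε
    filter_upwards [eventually_mem_feasD_inter_extraD A E f hconv hwint hwE] with k hk
    rw [dist_comm, ← hdist k]
    exact (Metric.infDist_le_dist_of_mem hk).trans_lt hwdist
end

section
/- Let d ≥ 2 and k = 2. Suppose X_1, X_2 are real symmetric d×d matrices with X := X_1 + X_2 satisfying X_i ⪰ 0, tr(X_i) = 1 for i = 1,2, and X ⪯ I_d, such that: (a) for some integer J ≥ 2 there exist positive scalars λ_1,...,λ_J with Σ_{j=1}^J λ_j = 1 and matrices U^{(j)} = (u_1^{(j)}, u_2^{(j)}) ∈ ℝ^{d×2} with (U^{(j)})ᵀU^{(j)} = I_2 such that X_i = Σ_{j=1}^J λ_j u_i^{(j)} (u_i^{(j)})ᵀ for i = 1,2; (b) rank(X_1) = rank(X_2) = 2; and (c) the largest eigenvalue of X equals 1. Then rank(X) ≤ 3. -/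
open Matrix

theorem sum_smul_vecMulVec_mulVec {m ι : Type*} [Fintype m] [Fintype ι]
    (lam : ι → ℝ) (u : ι → m → ℝ) (w : m → ℝ) :
    (∑ j, lam j • vecMulVec (u j) (u j)) *ᵥ w = ∑ j, (lam j * (u j ⬝ᵥ w)) • u j := by
  simp only [sum_mulVec, smul_mulVec, vecMulVec_mulVec, op_smul_eq_smul, smul_smul]

theorem mem_range_sum_smul_vecMulVec {m ι : Type*} [Fintype m] [Fintype ι]
    {lam : ι → ℝ} (hlam : ∀ j, 0 < lam j) (u : ι → m → ℝ) (j : ι) :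
    u j ∈ LinearMap.range (∑ j, lam j • vecMulVec (u j) (u j)).mulVecLin := by
  classical
  set B : Matrix m ι ℝ := Matrix.of fun a j => √(lam j) * u j a with hB
  have hX : ∑ j, lam j • vecMulVec (u j) (u j) = B * Bᵀ := by
    ext a b
    simp only [hB, Matrix.sum_apply, Matrix.smul_apply, vecMulVec_apply, mul_apply, transpose_apply,
      of_apply, smul_eq_mul]
    refine Finset.sum_congr rfl fun i _ => ?_
    linear_combination -(u i a * u i b) * Real.mul_self_sqrt (hlam i).le
  have hle : LinearMap.range (B * Bᵀ).mulVecLin ≤ LinearMap.range B.mulVecLin := by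
    rw [mulVecLin_mul]
    exact LinearMap.range_comp_le_range _ _
  rw [hX, Submodule.eq_of_le_of_finrank_eq hle (rank_self_mul_transpose B)]
  have hs : √(lam j) ≠ 0 := (Real.sqrt_pos.2 (hlam j)).ne'
  refine ⟨Pi.single j (√(lam j))⁻¹, ?_⟩
  ext a
  simp [hB, mulVec_single]
  field_simp

theorem rank_sum_smul_vecMulVec_le_one {m ι : Type*} [Fintype m] [Fintype ι]
    (lam : ι → ℝ) (u : ι → m → ℝ) {p : m → ℝ} (hu : ∀ j, u j ∈ Submodule.span ℝ {p}) :
    (∑ j, lam j • vecMulVec (u j) (u j)).rank ≤ 1 := by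
  have hle : LinearMap.range (∑ j, lam j • vecMulVec (u j) (u j)).mulVecLin ≤
      Submodule.span ℝ {p} := by
    rintro _ ⟨w, rfl⟩
    rw [mulVecLin_apply, sum_smul_vecMulVec_mulVec]
    exact Submodule.sum_mem _ fun j _ => Submodule.smul_mem _ _ (hu j)
  exact (Submodule.finrank_mono hle).trans ((finrank_span_le_card {p}).trans (by simp))

theorem rank_sum_smul_vecMulVec_le_one_of_smul_eq {m ι : Type*} [Fintype m] [Fintype ι]
    (lam : ι → ℝ) {u : ι → m → ℝ} {a : ι → ℝ} {p : m → ℝ} (hp : p ≠ 0)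
    (hu : ∀ j, a j • u j = p) :
    (∑ j, lam j • vecMulVec (u j) (u j)).rank ≤ 1 := by
  refine rank_sum_smul_vecMulVec_le_one lam u (p := p) fun j => ?_
  have ha : a j ≠ 0 := by
    rintro h
    exact hp (by rw [← hu j, h, zero_smul])
  exact Submodule.mem_span_singleton.2 ⟨(a j)⁻¹, by rw [← hu j, inv_smul_smul₀ ha]⟩

/-- A fixed vector of a convex combination of orthogonal projections onto the planes spanned by
the orthonormal pairs `u j`, `w j` lies in each of these planes. -/
theorem eq_proj_of_mulVec_eq_self {m ι : Type*} [Fintype m] [Fintype ι]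
    {lam : ι → ℝ} (hlam : ∀ j, 0 < lam j) (hsum : ∑ j, lam j = 1) {u w : ι → m → ℝ}
    (huu : ∀ j, u j ⬝ᵥ u j = 1) (hww : ∀ j, w j ⬝ᵥ w j = 1) (huw : ∀ j, u j ⬝ᵥ w j = 0)
    {v : m → ℝ}
    (hv : (∑ j, lam j • vecMulVec (u j) (u j) + ∑ j, lam j • vecMulVec (w j) (w j)) *ᵥ v = v)
    (j : ι) : v = (u j ⬝ᵥ v) • u j + (w j ⬝ᵥ v) • w j := by
  set r : ι → m → ℝ := fun j => v - ((u j ⬝ᵥ v) • u j + (w j ⬝ᵥ v) • w j) with hr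
  have hrr : ∀ j, r j ⬝ᵥ r j = v ⬝ᵥ v - (u j ⬝ᵥ v) ^ 2 - (w j ⬝ᵥ v) ^ 2 := by
    intro j
    simp only [hr, sub_dotProduct, dotProduct_sub, add_dotProduct, dotProduct_add,
      smul_dotProduct, dotProduct_smul, smul_eq_mul, huu, hww, huw, dotProduct_comm (w j) (u j),
      dotProduct_comm v (u j), dotProduct_comm v (w j)]
    ring
  have hvv : v ⬝ᵥ v = ∑ j, lam j * ((u j ⬝ᵥ v) ^ 2 + (w j ⬝ᵥ v) ^ 2) := by
    conv_lhs => enter [1]; rw [← hv]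
    rw [add_mulVec, sum_smul_vecMulVec_mulVec, sum_smul_vecMulVec_mulVec, add_dotProduct,
      sum_dotProduct, sum_dotProduct, ← Finset.sum_add_distrib]
    refine Finset.sum_congr rfl fun i _ => ?_
    simp only [smul_dotProduct, smul_eq_mul]
    ring
  have hzero : ∑ j, lam j * (r j ⬝ᵥ r j) = 0 := by
    have : ∀ j, lam j * (r j ⬝ᵥ r j) =
        lam j * (v ⬝ᵥ v) - lam j * ((u j ⬝ᵥ v) ^ 2 + (w j ⬝ᵥ v) ^ 2) := fun j => by
      rw [hrr]; ring
    simp only [this, Finset.sum_sub_distrib, ← Finset.sum_mul, hsum, ← hvv, one_mul, sub_self]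
  have hnonneg : ∀ j, 0 ≤ r j ⬝ᵥ r j := fun j =>
    Finset.sum_nonneg fun i _ => mul_self_nonneg _
  have hj := (Finset.sum_eq_zero_iff_of_nonneg fun i _ =>
    mul_nonneg (hlam i).le (hnonneg i)).1 hzero j (Finset.mem_univ j)
  have hrj : r j = 0 := dotProduct_self_eq_zero.1 ((mul_eq_zero.1 hj).resolve_left (hlam j).ne')
  exact sub_eq_zero.1 hrj

theorem disjoint_range_of_rank_add_le {m n : Type*} [Fintype m] [Fintype n]
    {A B : Matrix m n ℝ} (h : A.rank + B.rank ≤ (A + B).rank) :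
    Disjoint (LinearMap.range A.mulVecLin) (LinearMap.range B.mulVecLin) := by
  have hle : LinearMap.range (A + B).mulVecLin ≤
      LinearMap.range A.mulVecLin ⊔ LinearMap.range B.mulVecLin := by
    rw [mulVecLin_add]
    rintro _ ⟨x, rfl⟩
    exact Submodule.add_mem_sup ⟨x, rfl⟩ ⟨x, rfl⟩
  have h1 := Submodule.finrank_mono hle
  have h2 := Submodule.finrank_sup_add_finrank_inf_eq
    (LinearMap.range A.mulVecLin) (LinearMap.range B.mulVecLin)
  unfold Matrix.rank at h
  rw [disjoint_iff, ← Submodule.finrank_eq_zero (R := ℝ)]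
  omega

/-- **Counterexample proposition** (Appendix C): suppose `X = X₁ + X₂` is feasible for the
SDP relaxation, `(X₁, X₂)` is a strict convex combination of rank-one decompositions coming
from Stiefel matrices, `rank X₁ = rank X₂ = 2`, and the largest eigenvalue of `X` is `1`.
Then `rank X ≤ 3`. -/
theorem counterexample_rank_bound {d : ℕ} (hd : 2 ≤ d)
    (X1 X2 : Matrix (Fin d) (Fin d) ℝ)
    (hX1 : X1.PosSemidef) (hX2 : X2.PosSemidef)
    (htr1 : X1.trace = 1) (htr2 : X2.trace = 1)
    (hle : ((1 : Matrix (Fin d) (Fin d) ℝ) - (X1 + X2)).PosSemidef)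
    -- (a) strict convex combination of points of the decomposed Stiefel set
    (hconv : ∃ J : ℕ, 2 ≤ J ∧ ∃ lam : Fin J → ℝ, (∀ j, 0 < lam j) ∧ (∑ j, lam j = 1) ∧
      ∃ U : Fin J → Matrix (Fin d) (Fin 2) ℝ, (∀ j, (U j)ᵀ * U j = 1) ∧
        X1 = ∑ j, lam j • vecMulVec (fun a => U j a 0) (fun a => U j a 0) ∧
        X2 = ∑ j, lam j • vecMulVec (fun a => U j a 1) (fun a => U j a 1))
    -- (b) both summands have rank two
    (hrank1 : X1.rank = 2) (hrank2 : X2.rank = 2)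
    -- (c) the largest eigenvalue of `X = X₁ + X₂` equals one
    (hherm : (X1 + X2).IsHermitian)
    (hmaxeig : (⨆ i, hherm.eigenvalues i) = 1) :
    (X1 + X2).rank ≤ 3 := by
  obtain ⟨J, -, lam, hlam, hsum, U, hU, h1, h2⟩ := hconv
  have : Nonempty (Fin d) := ⟨⟨0, by omega⟩⟩
  have hdot : ∀ j a b, (fun i => U j i a) ⬝ᵥ (fun i => U j i b) =
      (1 : Matrix (Fin 2) (Fin 2) ℝ) a b := fun j a b => by
    rw [← hU j]; rfl
  obtain ⟨i, hi⟩ := exists_eq_ciSup_of_finite (f := hherm.eigenvalues)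
  rw [hmaxeig] at hi
  set v : Fin d → ℝ := (hherm.eigenvectorBasis i).ofLp with hvdef
  have hv0 : v ≠ 0 := fun h =>
    hherm.eigenvectorBasis.orthonormal.ne_zero i (by ext a; exact congrFun h a)
  have hv : (X1 + X2) *ᵥ v = v := by
    have := hherm.mulVec_eigenvectorBasis i
    rwa [hi, one_smul] at this
  by_contra! hrank
  have hdisj := disjoint_range_of_rank_add_le (A := X1) (B := X2) (by omega)
  have hplane := eq_proj_of_mulVec_eq_self hlam hsum (u := fun j a => U j a 0)
    (w := fun j a => U j a 1) (fun j => by simp [hdot]) (fun j => by simp [hdot])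
    (fun j => by simp [hdot]) (by rwa [← h1, ← h2])
  have hmem1 := mem_range_sum_smul_vecMulVec hlam fun j a => U j a 0
  have hmem2 := mem_range_sum_smul_vecMulVec hlam fun j a => U j a 1
  rw [← h1] at hmem1
  rw [← h2] at hmem2
  have hcomp : ∀ j, ((fun a => U j a 0) ⬝ᵥ v) • (fun a => U j a 0) = X1 *ᵥ v ∧
      ((fun a => U j a 1) ⬝ᵥ v) • (fun a => U j a 1) = X2 *ᵥ v := by
    intro j
    have heq : X1 *ᵥ v + X2 *ᵥ v =
        ((fun a => U j a 0) ⬝ᵥ v) • (fun a => U j a 0) +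
          ((fun a => U j a 1) ⬝ᵥ v) • (fun a => U j a 1) := by
      rw [← add_mulVec, hv]
      exact hplane j
    have hsub : ((fun a => U j a 0) ⬝ᵥ v) • (fun a => U j a 0) - X1 *ᵥ v =
        X2 *ᵥ v - ((fun a => U j a 1) ⬝ᵥ v) • (fun a => U j a 1) := by
      rw [sub_eq_sub_iff_add_eq_add, ← heq, add_comm]
    have hz := Submodule.disjoint_def.1 hdisj _
      (Submodule.sub_mem _ (Submodule.smul_mem _ ((fun a => U j a 0) ⬝ᵥ v) (hmem1 j)) ⟨v, rfl⟩)
      (by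
        rw [mulVecLin_apply, hsub]
        exact Submodule.sub_mem _ ⟨v, rfl⟩ (Submodule.smul_mem _ _ (hmem2 j)))
    rw [mulVecLin_apply] at hz
    exact ⟨sub_eq_zero.1 hz, (sub_eq_zero.1 (hsub ▸ hz)).symm⟩
  by_cases hp : X1 *ᵥ v = 0
  · by_cases hq : X2 *ᵥ v = 0
    · exact hv0 (by rw [← hv, add_mulVec, hp, hq, add_zero])
    · have := rank_sum_smul_vecMulVec_le_one_of_smul_eq lam hq fun j => (hcomp j).2
      rw [← h2] at this
      omega
  · have := rank_sum_smul_vecMulVec_le_one_of_smul_eq lam hp fun j => (hcomp j).1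
    rw [← h1] at this
    omega
end

section
/- Let v_1,...,v_k ∈ ℝ^d and define M_i := Σ_{j=i}^k v_j v_jᵀ for i = 1,...,k (so M_1 ⪰ M_2 ⪰ ... ⪰ M_k ⪰ 0). Suppose u_1,...,u_k ∈ ℝ^d are orthonormal and satisfy span{u_1,...,u_i} = span{v_1,...,v_i} for every i = 1,...,k. Then: (a) every primal feasible tuple (X_1,...,X_k) for (SDP-P) satisfies Σ_{i=1}^k tr(M_i X_i) ≤ tr(M_1); and (b) the tuple (u_1u_1ᵀ,...,u_ku_kᵀ) is primal feasible with Σ_{i=1}^k tr(M_i u_iu_iᵀ) = tr(M_1), hence it is primal optimal and the optimal value of (SDP-P) is tr(M_1) = Σ_{j=1}^k ‖v_j‖². -/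
open Matrix

/-- The nested matrices `M i = ∑_{j ≥ i} v_j v_jᵀ`. -/
noncomputable def nestedM {d k : ℕ} (v : Fin k → (Fin d → ℝ)) :
    Fin k → Matrix (Fin d) (Fin d) ℝ :=
  fun i => ∑ j ∈ Finset.univ.filter (fun j => i ≤ j), vecMulVec (v j) (v j)

theorem trace_vecMulVec_self_mul {n : Type*} [Fintype n] (w : n → ℝ) (X : Matrix n n ℝ) :
    (vecMulVec w w * X).trace = w ⬝ᵥ (X *ᵥ w) := by
  rw [vecMulVec_mul, trace_vecMulVec, dotProduct_mulVec, dotProduct_comm]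

/-- The objective for the nested data, with the two sums exchanged. -/
theorem primalObj_nestedM {d k : ℕ} (v : Fin k → (Fin d → ℝ))
    (X : Fin k → Matrix (Fin d) (Fin d) ℝ) :
    primalObj (nestedM v) X =
      ∑ j, ∑ i ∈ Finset.univ.filter (fun i => i ≤ j), v j ⬝ᵥ (X i *ᵥ v j) := by
  simp only [primalObj, nestedM, Finset.sum_mul, trace_sum, trace_vecMulVec_self_mul]
  simp only [Finset.sum_filter]
  exact Finset.sum_comm

theorem trace_nestedM_zero {d k : ℕ} (hk : 0 < k) (v : Fin k → (Fin d → ℝ)) :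
    (nestedM v ⟨0, hk⟩).trace = ∑ j, v j ⬝ᵥ v j := by
  have h : ∀ j : Fin k, (⟨0, hk⟩ : Fin k) ≤ j := fun j => Nat.zero_le j.val
  simp [nestedM, h, trace_sum, trace_vecMulVec]

theorem PrimalFeasible.sum_quadForm_le {d k : ℕ} {X : Fin k → Matrix (Fin d) (Fin d) ℝ}
    (hX : PrimalFeasible X) (s : Finset (Fin k)) (w : Fin d → ℝ) :
    ∑ i ∈ s, w ⬝ᵥ (X i *ᵥ w) ≤ w ⬝ᵥ w := by
  obtain ⟨hpos, -, hle⟩ := hX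
  have hnonneg : ∀ i, 0 ≤ w ⬝ᵥ (X i *ᵥ w) := fun i => by
    simpa using (hpos i).dotProduct_mulVec_nonneg w
  have htotal := hle.dotProduct_mulVec_nonneg w
  rw [sub_mulVec, one_mulVec, sum_mulVec, dotProduct_sub, dotProduct_sum, star_trivial] at htotal
  have hsub : ∑ i ∈ s, w ⬝ᵥ (X i *ᵥ w) ≤ ∑ i, w ⬝ᵥ (X i *ᵥ w) :=
    Finset.sum_le_sum_of_subset_of_nonneg (Finset.subset_univ s) fun i _ _ => hnonneg i
  linarith

theorem dotProduct_vecMulVec_self_mulVec {n : Type*} [Fintype n] (a w : n → ℝ) :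
    w ⬝ᵥ (vecMulVec a a *ᵥ w) = (a ⬝ᵥ w) ^ 2 := by
  rw [← trace_vecMulVec_self_mul, vecMulVec_mul_vecMulVec, trace_vecMulVec, dotProduct_smul,
    smul_eq_mul, dotProduct_comm w a, sq]

/-- Bessel's inequality for the dot product. -/
theorem sum_sq_dotProduct_le {ι n : Type*} [Fintype ι] [DecidableEq ι] [Fintype n]
    {u : ι → n → ℝ} (hu : ∀ i j, u i ⬝ᵥ u j = if i = j then (1 : ℝ) else 0) (w : n → ℝ) :
    ∑ i, (u i ⬝ᵥ w) ^ 2 ≤ w ⬝ᵥ w := by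
  have h : 0 ≤ (w - ∑ i, (u i ⬝ᵥ w) • u i) ⬝ᵥ (w - ∑ i, (u i ⬝ᵥ w) • u i) :=
    Finset.sum_nonneg fun _ _ => mul_self_nonneg _
  simp only [sub_dotProduct, dotProduct_sub, sum_dotProduct, dotProduct_sum, smul_dotProduct,
    dotProduct_smul, hu, smul_eq_mul, dotProduct_comm w, mul_ite, mul_one, mul_zero,
    Finset.sum_ite_eq', Finset.mem_univ, if_true, sub_self,
    Finset.sum_const_zero, sub_zero] at h
  simp only [sq]
  linarith

/-- Orthonormal expansion of a vector in the span of part of an orthonormal family. -/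
theorem eq_sum_of_mem_span_image {ι n : Type*} [DecidableEq ι] [Fintype n]
    {u : ι → n → ℝ} (hu : ∀ i j, u i ⬝ᵥ u j = if i = j then (1 : ℝ) else 0)
    (s : Finset ι) {w : n → ℝ} (hw : w ∈ Submodule.span ℝ (u '' s)) :
    w = ∑ i ∈ s, (u i ⬝ᵥ w) • u i := by
  induction hw using Submodule.span_induction with
  | mem x hx =>
    obtain ⟨j, hj, rfl⟩ := hx
    simp [hu, Finset.mem_coe.mp hj]
  | zero => simp
  | add x y _ _ hx hy =>
    simp only [dotProduct_add, add_smul, Finset.sum_add_distrib]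
    rw [← hx, ← hy]
  | smul c x _ hx =>
    simp only [dotProduct_smul, smul_assoc, ← Finset.smul_sum]
    rw [← hx]

/-- Parseval's identity for a vector in the span of part of an orthonormal family. -/
theorem sum_sq_dotProduct_eq {ι n : Type*} [DecidableEq ι] [Fintype n]
    {u : ι → n → ℝ} (hu : ∀ i j, u i ⬝ᵥ u j = if i = j then (1 : ℝ) else 0)
    (s : Finset ι) {w : n → ℝ} (hw : w ∈ Submodule.span ℝ (u '' s)) :
    ∑ i ∈ s, (u i ⬝ᵥ w) ^ 2 = w ⬝ᵥ w := by
  have h := congrArg (fun x => x ⬝ᵥ w) (eq_sum_of_mem_span_image hu s hw)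
  simp only [sum_dotProduct, smul_dotProduct, smul_eq_mul] at h
  simp only [h, sq]

theorem primalFeasible_vecMulVec {d k : ℕ} {u : Fin k → (Fin d → ℝ)}
    (hu : ∀ i j, u i ⬝ᵥ u j = if i = j then (1 : ℝ) else 0) :
    PrimalFeasible fun i => vecMulVec (u i) (u i) := by
  have hpos : ∀ i, (vecMulVec (u i) (u i)).PosSemidef := fun i => by
    simpa using posSemidef_vecMulVec_self_star (u i)
  refine ⟨hpos, fun i => by simp [trace_vecMulVec, hu], ?_⟩
  refine PosSemidef.of_dotProduct_mulVec_nonneg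
    (isHermitian_one.sub (posSemidef_sum _ fun i _ => hpos i).isHermitian) fun w => ?_
  rw [sub_mulVec, one_mulVec, sum_mulVec, dotProduct_sub, dotProduct_sum, star_trivial]
  simp only [dotProduct_vecMulVec_self_mulVec]
  exact sub_nonneg.mpr (sum_sq_dotProduct_le hu w)

/-- **An exactly solvable family that need not be almost commuting** (Appendix E): for the
nested data `M i = ∑_{j ≥ i} v_j v_jᵀ` and an orthonormal family `u` adapted to the flag of
the `v`'s, the rank-one tuple `(u₁u₁ᵀ, …, u_ku_kᵀ)` is optimal for (SDP-P) with optimal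
value `tr M₁ = ∑ j, ‖v_j‖²`. -/
theorem nested_instance_solution {d k : ℕ} (hk : 0 < k) (hkd : k ≤ d)
    (v u : Fin k → (Fin d → ℝ))
    (hu : ∀ i j, u i ⬝ᵥ u j = if i = j then (1 : ℝ) else 0)
    (hspan : ∀ i : Fin k,
      Submodule.span ℝ (u '' {j | j ≤ i}) = Submodule.span ℝ (v '' {j | j ≤ i})) :
    -- (a) every primal feasible tuple has objective at most `tr M₁`
    (∀ X : Fin k → Matrix (Fin d) (Fin d) ℝ, PrimalFeasible X →
      primalObj (nestedM v) X ≤ (nestedM v ⟨0, hk⟩).trace) ∧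
    -- (b) the rank-one tuple built from `u` is feasible and attains `tr M₁`, hence optimal
    PrimalFeasible (fun i => vecMulVec (u i) (u i)) ∧
    primalObj (nestedM v) (fun i => vecMulVec (u i) (u i)) = (nestedM v ⟨0, hk⟩).trace ∧
    (∀ X : Fin k → Matrix (Fin d) (Fin d) ℝ, PrimalFeasible X →
      primalObj (nestedM v) X ≤ primalObj (nestedM v) (fun i => vecMulVec (u i) (u i))) ∧
    (nestedM v ⟨0, hk⟩).trace = ∑ j, v j ⬝ᵥ v j := by
  have hupper : ∀ X : Fin k → Matrix (Fin d) (Fin d) ℝ, PrimalFeasible X →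
      primalObj (nestedM v) X ≤ (nestedM v ⟨0, hk⟩).trace := fun X hX => by
    rw [primalObj_nestedM, trace_nestedM_zero]
    exact Finset.sum_le_sum fun j _ => hX.sum_quadForm_le _ _
  have hattained : primalObj (nestedM v) (fun i => vecMulVec (u i) (u i)) =
      (nestedM v ⟨0, hk⟩).trace := by
    rw [primalObj_nestedM, trace_nestedM_zero]
    refine Finset.sum_congr rfl fun j _ => ?_
    simp only [dotProduct_vecMulVec_self_mulVec]
    refine sum_sq_dotProduct_eq hu _ ?_
    rw [Finset.coe_filter_univ, hspan j]
    exact Submodule.subset_span ⟨j, le_refl j, rfl⟩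
  exact ⟨hupper, primalFeasible_vecMulVec hu, hattained,
    fun X hX => hattained ▸ hupper X hX, trace_nestedM_zero hk v⟩
end
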